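/- arXiv:2107.01741 — 4 statements merged into one kernel-verified Lean document; each statement's English description precedes it below -/
import Mathlib

section
/- Let p ∈ [1, p_c) and γ ∈ ℝ, and suppose ‖f(·,t)‖_{L^1(ℝ^N)} ≤ C₀ (1+t)^{−γ} for all t ≥ 0. Then the mild solution u satisfies, for some constant C and all t ≥ 2: ‖u(·,t)‖_{L^p(ℝ^N)} ≤ C t^{−γ+α−(αN/(2β))(1−1/p)} if γ < 1; ‖u(·,t)‖_{L^p(ℝ^N)} ≤ C t^{−1+α−(αN/(2β))(1−1/p)} log t if γ = 1; and ‖u(·,t)‖_{L^p(ℝ^N)} ≤ C t^{−1+α−(αN/(2β))(1−1/p)} if γ > 1. -/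
open MeasureTheory Real Set Filter
open scoped ENNReal Pointwise

lemma aux_minkowski {X Z : Type*} [MeasurableSpace X] [MeasurableSpace Z]
    (μ : Measure X) (ν : Measure Z) [SFinite μ] [SFinite ν]
    (k : X → Z → ℝ≥0∞) (hk : Measurable (Function.uncurry k))
    (w : Z → ℝ≥0∞) (hw : Measurable w) (p : ℝ) (hp : 1 ≤ p)
    (hw0 : ∀ᵐ z ∂ν, w z ≠ 0) (hwt : ∀ᵐ z ∂ν, w z ≠ ∞)
    (hkw : ∀ᵐ z ∂ν, ∫⁻ x, k x z ^ p ∂μ ≤ w z ^ p) :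
    ∫⁻ x, (∫⁻ z, k x z ∂ν) ^ p ∂μ ≤ (∫⁻ z, w z ∂ν) ^ p := by
  have hp0 : 0 < p := by linarith
  have hkx : ∀ x, Measurable (k x) := fun x => hk.comp measurable_prodMk_left
  have hkz : ∀ z, Measurable (fun x => k x z) := fun z => hk.comp measurable_prodMk_right
  have h1 : ∀ x, (∫⁻ z, k x z ∂ν) ^ p ≤
      (∫⁻ z, k x z ^ p * w z ^ (1 - p) ∂ν) * (∫⁻ z, w z ∂ν) ^ (p - 1) := by
    intro x
    have e : ∫⁻ z, k x z ∂ν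
        = ∫⁻ z, (k x z ^ p * w z ^ (1 - p)) ^ (1 / p) * (w z) ^ (1 - 1 / p) ∂ν := by
      apply lintegral_congr_ae
      filter_upwards [hw0, hwt] with z h0 ht
      rw [ENNReal.mul_rpow_of_nonneg _ _ (by positivity), ← ENNReal.rpow_mul, ← ENNReal.rpow_mul,
        mul_assoc, ← ENNReal.rpow_add _ _ h0 ht]
      have : (1 - p) * (1 / p) + (1 - 1 / p) = 0 := by field_simp; ring
      rw [this, mul_one_div_cancel hp0.ne']
      simp
    have h2 := ENNReal.lintegral_mul_norm_pow_le (μ := ν)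
      (f := fun z => k x z ^ p * w z ^ (1 - p)) (g := w)
      (((hkx x).pow_const p).mul (hw.pow_const _)).aemeasurable hw.aemeasurable
      (p := 1 / p) (q := 1 - 1 / p) (by positivity)
      (by rw [sub_nonneg, div_le_one hp0]; exact hp) (by ring)
    rw [← e] at h2
    calc _ ≤ _ := ENNReal.rpow_le_rpow h2 hp0.le
      _ = _ := by
        rw [ENNReal.mul_rpow_of_nonneg _ _ hp0.le, ← ENNReal.rpow_mul, ← ENNReal.rpow_mul,
          one_div_mul_cancel hp0.ne', ENNReal.rpow_one]
        congr 2
        field_simp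
  calc _ ≤ ∫⁻ x, (∫⁻ z, k x z ^ p * w z ^ (1 - p) ∂ν) * (∫⁻ z, w z ∂ν) ^ (p - 1) ∂μ :=
        lintegral_mono h1
    _ = (∫⁻ x, ∫⁻ z, k x z ^ p * w z ^ (1 - p) ∂ν ∂μ) * (∫⁻ z, w z ∂ν) ^ (p - 1) := by
        rw [lintegral_mul_const]
        apply Measurable.lintegral_prod_right (f := fun x z => k x z ^ p * w z ^ (1 - p))
        exact (Measurable.pow_const hk p).mul ((hw.comp measurable_snd).pow_const _)
    _ = (∫⁻ z, ∫⁻ x, k x z ^ p * w z ^ (1 - p) ∂μ ∂ν) * (∫⁻ z, w z ∂ν) ^ (p - 1) := by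
        rw [lintegral_lintegral_swap]
        exact ((Measurable.pow_const hk p).mul ((hw.comp measurable_snd).pow_const _)).aemeasurable
    _ ≤ (∫⁻ z, w z ∂ν) * (∫⁻ z, w z ∂ν) ^ (p - 1) := by
        gcongr ?_ * _
        apply lintegral_mono_ae
        filter_upwards [hw0, hwt, hkw] with z h0 ht h
        rw [lintegral_mul_const _ ((hkz z).pow_const p)]
        calc _ ≤ w z ^ p * w z ^ (1 - p) := by gcongr
          _ = w z := by rw [← ENNReal.rpow_add _ _ h0 ht]; simp
    _ = _ := by
        nth_rw 1 [← ENNReal.rpow_one (∫⁻ z, w z ∂ν)]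
        rw [← ENNReal.rpow_add_of_nonneg _ _ (by norm_num) (by linarith)]
        congr 1; ring

lemma aux_G (N : ℕ) (hN : 0 < N) (G : EuclideanSpace ℝ (Fin N) → ℝ)
    (c a b p : ℝ) (hc : 0 < c) (hp : 1 ≤ p) (hGn : ∀ ξ, 0 ≤ G ξ)
    (ha : a * p < N) (hb : N < b * p)
    (hin : ∀ ξ, 0 < ‖ξ‖ → ‖ξ‖ ≤ 1 → G ξ ≤ c * ‖ξ‖ ^ (-a))
    (hout : ∀ ξ, 1 ≤ ‖ξ‖ → G ξ ≤ c * ‖ξ‖ ^ (-b)) :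
    ∫⁻ ξ, ‖G ξ‖ₑ ^ p < ∞ := by
  have hp0 : 0 < p := by linarith
  have hNr : (0:ℝ) < N := by exact_mod_cast hN
  have : Nonempty (Fin N) := ⟨⟨0, hN⟩⟩
  let g : ℝ → ℝ := fun r => if r ≤ 1 then (c * r ^ (-a)) ^ p else (c * r ^ (-b)) ^ p
  have hint : Integrable (fun ξ : EuclideanSpace ℝ (Fin N) => g ‖ξ‖) volume := by
    rw [integrable_fun_norm_addHaar]
    rw [← Ioc_union_Ioi_eq_Ioi (zero_le_one (α := ℝ))]
    have key : ∀ e r : ℝ, 0 < r → r ^ (N - 1) • (c * r ^ (-e)) ^ p = c ^ p * r ^ (N - 1 - e * p) := by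
      intro e r hr
      rw [Real.mul_rpow hc.le (by positivity), ← Real.rpow_mul hr.le, smul_eq_mul,
        ← Real.rpow_natCast, Nat.cast_sub hN, mul_left_comm, ← Real.rpow_add hr]
      congr 2; push_cast; ring
    rw [integrableOn_union]
    constructor
    · have : IntegrableOn (fun r : ℝ => c ^ p * r ^ (N - 1 - a * p)) (Ioc 0 1) := by
        apply Integrable.const_mul
        rw [← IntegrableOn, integrableOn_Ioc_iff_integrableOn_Ioo,
          intervalIntegral.integrableOn_Ioo_rpow_iff zero_lt_one]
        linarith
      refine this.congr_fun (fun r hr => ?_) measurableSet_Ioc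
      simp only [g, if_pos hr.2, finrank_euclideanSpace, Fintype.card_fin]
      exact (key a r hr.1).symm
    · have : IntegrableOn (fun r : ℝ => c ^ p * r ^ (N - 1 - b * p)) (Ioi 1) := by
        apply Integrable.const_mul
        apply integrableOn_Ioi_rpow_of_lt _ zero_lt_one
        linarith
      refine this.congr_fun (fun r hr => ?_) measurableSet_Ioi
      have hr' : (1:ℝ) < r := hr
      simp only [g, if_neg (not_le.2 hr'), finrank_euclideanSpace, Fintype.card_fin]
      exact (key b r (by linarith)).symm
  refine lt_of_le_of_lt ?_ hint.lintegral_lt_top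
  apply lintegral_mono_ae
  have h0 : ∀ᵐ ξ : EuclideanSpace ℝ (Fin N), ξ ≠ 0 := by
    simp [ae_iff]
  filter_upwards [h0] with ξ hξ
  have hn : 0 < ‖ξ‖ := norm_pos_iff.2 hξ
  rw [Real.enorm_of_nonneg (hGn ξ), ENNReal.ofReal_rpow_of_nonneg (hGn ξ) hp0.le]
  apply ENNReal.ofReal_le_ofReal
  simp only [g]
  split_ifs with h
  · exact Real.rpow_le_rpow (hGn ξ) (hin ξ hn h) hp0.le
  · exact Real.rpow_le_rpow (hGn ξ) (hout ξ (not_le.1 h).le) hp0.le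

lemma aux_scale (N : ℕ) (g : EuclideanSpace ℝ (Fin N) → ℝ≥0∞) (hg : Measurable g)
    (r : ℝ) (hr : 0 < r) (y : EuclideanSpace ℝ (Fin N)) :
    ∫⁻ x, g (r • (x - y)) = ENNReal.ofReal (r ^ (-(N:ℝ))) * ∫⁻ x, g x := by
  rw [lintegral_sub_right_eq_self (fun x => g (r • x)) y]
  have := Measure.map_addHaar_smul (volume : Measure (EuclideanSpace ℝ (Fin N))) hr.ne'
  rw [← lintegral_map (f := g) (g := fun x => r • x) hg (by fun_prop), this,
    lintegral_smul_measure]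
  simp only [finrank_euclideanSpace, Fintype.card_fin, smul_eq_mul]
  congr 2
  rw [Real.rpow_neg hr.le, Real.rpow_natCast, abs_of_nonneg (by positivity)]

lemma aux_pow (b t v : ℝ) (ht : 0 < t) (h1 : t / 2 ≤ v) (h2 : v ≤ 2 * t) :
    v ^ b ≤ 2 ^ |b| * t ^ b := by
  have hv : 0 < v := by linarith
  rcases le_or_gt 0 b with hb | hb
  · rw [abs_of_nonneg hb, ← Real.mul_rpow (by norm_num) ht.le]
    exact Real.rpow_le_rpow hv.le h2 hb
  · rw [abs_of_neg hb]
    calc v ^ b ≤ (t / 2) ^ b := Real.rpow_le_rpow_of_nonpos (by linarith) h1 hb.le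
      _ = _ := by
        rw [Real.div_rpow ht.le (by norm_num), Real.rpow_neg (by norm_num)]
        ring

lemma aux_int1 (a t : ℝ) (ha : -1 < a) (ht : 0 < t) :
    ∫⁻ s in Ioo 0 t, ENNReal.ofReal ((t - s) ^ a) = ENNReal.ofReal (t ^ (a + 1) / (a + 1)) := by
  have h1 : IntervalIntegrable (fun s : ℝ => (t - s) ^ a) volume 0 t := by
    have := (intervalIntegral.intervalIntegrable_rpow' (a := 0) (b := t) ha).comp_sub_left t
    simpa using this.symm
  have h2 : ∫ s in (0:ℝ)..t, (t - s) ^ a = t ^ (a + 1) / (a + 1) := by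
    rw [intervalIntegral.integral_comp_sub_left (fun x => x ^ a) t, integral_rpow (Or.inl ha)]
    simp [Real.zero_rpow (by linarith : a + 1 ≠ 0)]
  rw [← h2, intervalIntegral.integral_of_le ht.le, integral_Ioc_eq_integral_Ioo,
    ofReal_integral_eq_lintegral_ofReal]
  · rw [intervalIntegrable_iff_integrableOn_Ioo_of_le ht.le] at h1
    exact h1
  · filter_upwards [ae_restrict_mem measurableSet_Ioo] with s hs
    exact Real.rpow_nonneg (by linarith [hs.2]) _

lemma aux_int2 (γ t : ℝ) (ht : 0 < t) :
    ∫⁻ s in Ioo 0 t, ENNReal.ofReal ((1 + s) ^ (-γ)) =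
      ENNReal.ofReal (∫ x in (1:ℝ)..(1 + t), x ^ (-γ)) := by
  have h1 : ContinuousOn (fun s : ℝ => (1 + s) ^ (-γ)) (Icc 0 t) := by
    intro s hs
    apply ContinuousAt.continuousWithinAt
    apply ContinuousAt.rpow_const (by fun_prop)
    left; have := hs.1; positivity
  have h2 : ∫ x in (1:ℝ)..(1 + t), x ^ (-γ) = ∫ s in (0:ℝ)..t, (1 + s) ^ (-γ) := by
    rw [intervalIntegral.integral_comp_add_left (fun x => x ^ (-γ)) 1]; simp
  rw [h2, intervalIntegral.integral_of_le ht.le, integral_Ioc_eq_integral_Ioo,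
    ofReal_integral_eq_lintegral_ofReal]
  · exact h1.integrableOn_Icc.mono_set Ioo_subset_Icc_self
  · filter_upwards [ae_restrict_mem measurableSet_Ioo] with s hs
    exact Real.rpow_nonneg (by linarith [hs.1]) _

lemma aux_time (a γ t J : ℝ) (ha : -1 < a) (ht : 2 ≤ t)
    (hJ : ∫ x in (1:ℝ)..(1 + t), x ^ (-γ) ≤ J) (hJ0 : 0 ≤ J) :
    ∫⁻ s in Ioo 0 t, ENNReal.ofReal ((t - s) ^ a) * ENNReal.ofReal ((1 + s) ^ (-γ)) ≤
      ENNReal.ofReal (2 ^ |a| * t ^ a * J + 2 ^ |-γ| * t ^ (-γ) * (t ^ (a + 1) / (a + 1))) := by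
  have ht0 : 0 < t := by linarith
  calc _ ≤ ∫⁻ s in Ioo 0 t, (ENNReal.ofReal (2 ^ |a| * t ^ a) * ENNReal.ofReal ((1 + s) ^ (-γ)) +
          ENNReal.ofReal (2 ^ |-γ| * t ^ (-γ)) * ENNReal.ofReal ((t - s) ^ a)) := by
        apply setLIntegral_mono (by fun_prop)
        intro s hs
        rcases le_total s (t / 2) with h | h
        · refine le_trans ?_ le_self_add
          gcongr
          exact aux_pow a t (t - s) ht0 (by linarith) (by linarith [hs.1])
        · refine le_trans ?_ le_add_self
          rw [mul_comm]
          gcongr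
          exact aux_pow (-γ) t (1 + s) ht0 (by linarith) (by linarith [hs.2])
    _ ≤ _ := by
        rw [lintegral_add_left (by fun_prop), lintegral_const_mul _ (by fun_prop),
          lintegral_const_mul _ (by fun_prop), aux_int1 a t ha ht0, aux_int2 γ t ht0,
          ← ENNReal.ofReal_mul (by positivity), ← ENNReal.ofReal_mul (by positivity)]
        have : 0 < a + 1 := by linarith
        rw [ENNReal.ofReal_add (by positivity) (by positivity)]
        gcongr

lemma aux_J1 (γ t : ℝ) (hγ : γ < 1) (ht : 2 ≤ t) :
    ∫ x in (1:ℝ)..(1 + t), x ^ (-γ) ≤ 2 ^ (1 - γ) / (1 - γ) * t ^ (1 - γ) := by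
  rw [integral_rpow (Or.inl (by linarith)), Real.one_rpow]
  have h : (1 + t) ^ (1 - γ) ≤ (2 * t) ^ (1 - γ) :=
    Real.rpow_le_rpow (by linarith) (by linarith) (by linarith)
  rw [Real.mul_rpow (by norm_num) (by linarith)] at h
  rw [div_mul_eq_mul_div, show -γ + 1 = 1 - γ by ring]
  have : 0 < 1 - γ := by linarith
  gcongr; linarith

lemma aux_J2 (t : ℝ) (ht : 2 ≤ t) :
    ∫ x in (1:ℝ)..(1 + t), x ^ (-(1:ℝ)) ≤ 2 * Real.log t := by
  simp_rw [Real.rpow_neg_one]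
  rw [integral_inv_of_pos one_pos (by linarith), div_one]
  have : Real.log (1 + t) ≤ Real.log (t * t) := Real.log_le_log (by linarith) (by nlinarith)
  rw [Real.log_mul (by linarith) (by linarith)] at this
  linarith

lemma aux_J3 (γ t : ℝ) (hγ : 1 < γ) (ht : 2 ≤ t) :
    ∫ x in (1:ℝ)..(1 + t), x ^ (-γ) ≤ 1 / (γ - 1) := by
  rw [integral_rpow (Or.inr ⟨by linarith, by
    rw [uIcc_of_le (by linarith)]; simp⟩), Real.one_rpow]
  have h : 0 ≤ (1 + t) ^ (-γ + 1) := Real.rpow_nonneg (by linarith) _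
  have : 0 < γ - 1 := by linarith
  rw [show -γ + 1 = -(γ - 1) by ring] at *
  rw [div_neg, ← neg_div]
  gcongr; linarith

lemma aux_main
    (N : ℕ) (α β : ℝ)
    (hα : 0 < α ∧ α < 1) (hβ : 0 < β ∧ β ≤ 1) (hN : 4 * β < (N : ℝ))
    (G : EuclideanSpace ℝ (Fin N) → ℝ)
    (hGmeas : Measurable G) (hGnonneg : ∀ ξ, 0 ≤ G ξ)
    (c₂ : ℝ) (hc₂ : 0 < c₂)
    (hGin : ∀ ξ : EuclideanSpace ℝ (Fin N), 0 < ‖ξ‖ → ‖ξ‖ ≤ 1 →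
      G ξ ≤ c₂ * ‖ξ‖ ^ (4 * β - (N : ℝ)))
    (hGout : ∀ ξ : EuclideanSpace ℝ (Fin N), 1 ≤ ‖ξ‖ →
      G ξ ≤ c₂ * ‖ξ‖ ^ (-((N : ℝ) + 2 * β)))
    (Y : EuclideanSpace ℝ (Fin N) → ℝ → ℝ)
    (hY : ∀ x t, Y x t = t ^ (α - 1 - α * (N : ℝ) / (2 * β)) * G ((t ^ (-(α / (2 * β)))) • x))
    (f : EuclideanSpace ℝ (Fin N) → ℝ → ℝ)
    (hfmeas : Measurable (Function.uncurry f))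
    (γ : ℝ) (C₀ : ℝ) (hC₀ : 0 < C₀)
    (hf1 : ∀ t : ℝ, 0 ≤ t →
      eLpNorm (fun y => f y t) 1 volume ≤ ENNReal.ofReal (C₀ * (1 + t) ^ (-γ)))
    (u : EuclideanSpace ℝ (Fin N) → ℝ → ℝ)
    (hu : ∀ x t, u x t = ∫ s in Set.Ioc (0:ℝ) t, ∫ y, Y (x - y) (t - s) * f y s)
    (p : ℝ) (hp1 : 1 ≤ p) (hpc : p < (N : ℝ) / ((N : ℝ) - 2 * β)) :
    ∃ A : ℝ, 0 < A ∧ ∀ t : ℝ, 2 ≤ t → ∀ a : ℝ,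
      a = α - 1 - (α * (N : ℝ) / (2 * β)) * (1 - 1 / p) →
      eLpNorm (fun x => u x t) (ENNReal.ofReal p) volume ≤ ENNReal.ofReal A *
        ∫⁻ s in Ioo 0 t, ENNReal.ofReal ((t - s) ^ a) * ENNReal.ofReal ((1 + s) ^ (-γ)) := by
  obtain ⟨hα0, hα1⟩ := hα
  obtain ⟨hβ0, hβ1⟩ := hβ
  have hp0 : 0 < p := by linarith
  have hNr : (0:ℝ) < N := by linarith
  have hN0 : 0 < N := by exact_mod_cast hNr
  have hpc' : p * (N - 2 * β) < N := by rwa [lt_div_iff₀ (by linarith)] at hpc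
  have hK := aux_G N hN0 G c₂ (N - 4 * β) (N + 2 * β) p hc₂ hp1 hGnonneg
    (by nlinarith) (by nlinarith) (by simpa using hGin) hGout
  set K := ∫⁻ ξ, ‖G ξ‖ₑ ^ p with hKdef
  set R : ℝ := (K.toReal + 1) ^ (1 / p) with hR
  have hR0 : 0 < R := by positivity
  have hKR : K ≤ ENNReal.ofReal (R ^ p) := by
    rw [hR, ← Real.rpow_mul (by positivity), one_div_mul_cancel hp0.ne', Real.rpow_one]
    rw [ENNReal.le_ofReal_iff_toReal_le hK.ne (by positivity)]
    linarith
  refine ⟨R * C₀, by positivity, fun t ht a ha => ?_⟩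
  let μ₀ : Measure (ℝ × EuclideanSpace ℝ (Fin N)) := (volume.restrict (Ioo 0 t)).prod volume
  have hYm : Measurable (Function.uncurry Y) := by
    have : Function.uncurry Y = fun q : EuclideanSpace ℝ (Fin N) × ℝ =>
      q.2 ^ (α - 1 - α * (N : ℝ) / (2 * β)) * G ((q.2 ^ (-(α / (2 * β)))) • q.1) := by
      ext q; exact hY _ _
    rw [this]
    refine (measurable_snd.pow_const _).mul (hGmeas.comp ?_)
    exact (measurable_snd.pow_const _).smul measurable_fst
  let F : ℝ × EuclideanSpace ℝ (Fin N) → ℝ≥0∞ := fun z => ‖f z.2 z.1‖ₑ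
  have hF : Measurable F := (hfmeas.comp measurable_swap).enorm
  let ν := μ₀.withDensity F
  let k : EuclideanSpace ℝ (Fin N) → ℝ × EuclideanSpace ℝ (Fin N) → ℝ≥0∞ :=
    fun x z => ‖Y (x - z.2) (t - z.1)‖ₑ
  have hk : Measurable (Function.uncurry k) := by
    have h : Measurable (fun q : EuclideanSpace ℝ (Fin N) × (ℝ × EuclideanSpace ℝ (Fin N)) =>
      (q.1 - q.2.2, t - q.2.1)) := by fun_prop
    exact (hYm.comp h).enorm
  let w : ℝ × EuclideanSpace ℝ (Fin N) → ℝ≥0∞ := fun z => ENNReal.ofReal (R * (t - z.1) ^ a)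
  have hw : Measurable w := by fun_prop
  have hae : ∀ᵐ z ∂ν, z.1 ∈ Ioo 0 t := by
    apply (withDensity_absolutelyContinuous μ₀ F).ae_le
    exact Measure.quasiMeasurePreserving_fst.ae (ae_restrict_mem measurableSet_Ioo)
  have hM := aux_minkowski volume ν k hk w hw p hp1
    (by
      filter_upwards [hae] with z hz
      have : 0 < t - z.1 := by linarith [hz.2]
      have : 0 < R * (t - z.1) ^ a := by positivity
      simpa [w] using this)
    (by simp [w])
    (by
      filter_upwards [hae] with z hz
      have hτ : 0 < t - z.1 := by linarith [hz.2]
      obtain ⟨τ, hτd⟩ : ∃ τ, τ = t - z.1 := ⟨_, rfl⟩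
      rw [← hτd] at hτ
      have e1 : ∀ x, k x z ^ p = ENNReal.ofReal (τ ^ ((α - 1 - α * (N : ℝ) / (2 * β)) * p)) *
          (fun ξ => ‖G ξ‖ₑ ^ p) ((τ ^ (-(α / (2 * β)))) • (x - z.2)) := by
        intro x
        simp only [k, hY, ← hτd]
        rw [enorm_mul, ENNReal.mul_rpow_of_nonneg _ _ hp0.le,
          Real.enorm_of_nonneg (Real.rpow_nonneg hτ.le _),
          ENNReal.ofReal_rpow_of_nonneg (Real.rpow_nonneg hτ.le _) hp0.le, ← Real.rpow_mul hτ.le]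
      have hgm : Measurable (fun ξ => ‖G ξ‖ₑ ^ p) := hGmeas.enorm.pow_const p
      have hgm' : Measurable (fun x =>
          (fun ξ => ‖G ξ‖ₑ ^ p) ((τ ^ (-(α / (2 * β)))) • (x - z.2))) :=
        hgm.comp (by fun_prop)
      rw [lintegral_congr e1, lintegral_const_mul _ hgm',
        aux_scale N _ hgm _ (Real.rpow_pos_of_pos hτ _), ← hKdef, ← mul_assoc,
        ← ENNReal.ofReal_mul (Real.rpow_nonneg hτ.le _), ← Real.rpow_mul hτ.le,
        ← Real.rpow_add hτ]
      simp only [w, ← hτd]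
      rw [ENNReal.ofReal_rpow_of_nonneg (by positivity) hp0.le,
        Real.mul_rpow hR0.le (Real.rpow_nonneg hτ.le _), ← Real.rpow_mul hτ.le, mul_comm (R ^ p),
        ENNReal.ofReal_mul (Real.rpow_nonneg hτ.le _)]
      have e2 : (α - 1 - α * (N : ℝ) / (2 * β)) * p + -(α / (2 * β)) * -(N : ℝ) = a * p := by
        rw [ha]; field_simp; ring
      rw [e2]
      gcongr)
  have hux : ∀ x, ‖u x t‖ₑ ≤ ∫⁻ z, k x z ∂ν := by
    intro x
    have hkx : Measurable (k x) := hk.comp measurable_prodMk_left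
    rw [lintegral_withDensity_eq_lintegral_mul _ hF hkx, lintegral_prod _ (hF.mul hkx).aemeasurable,
      hu, ← restrict_Ioo_eq_restrict_Ioc]
    refine (enorm_integral_le_lintegral_enorm _).trans ?_
    gcongr with s
    refine (enorm_integral_le_lintegral_enorm _).trans ?_
    gcongr with y
    simp [F, k, mul_comm]
  have hwi : ∫⁻ z, w z ∂ν ≤ ENNReal.ofReal (R * C₀) *
        ∫⁻ s in Ioo 0 t, ENNReal.ofReal ((t - s) ^ a) * ENNReal.ofReal ((1 + s) ^ (-γ)) := by
    rw [lintegral_withDensity_eq_lintegral_mul _ hF hw, lintegral_prod _ (hF.mul hw).aemeasurable,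
      ← lintegral_const_mul _ (by fun_prop)]
    apply setLIntegral_mono (by fun_prop)
    intro s hs
    have h1 := hf1 s hs.1.le
    rw [eLpNorm_one_eq_lintegral_enorm] at h1
    simp only [F, w, Pi.mul_apply]
    have hfs : Measurable (fun y => ‖f y s‖ₑ) := (hfmeas.comp measurable_prodMk_right).enorm
    rw [lintegral_mul_const _ hfs]
    calc _ ≤ ENNReal.ofReal (C₀ * (1 + s) ^ (-γ)) * ENNReal.ofReal (R * (t - s) ^ a) := by gcongr
      _ = _ := by
        have : 0 < t - s := by linarith [hs.2]
        have := hs.1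
        rw [← ENNReal.ofReal_mul (by positivity), ← ENNReal.ofReal_mul (by positivity),
          ← ENNReal.ofReal_mul (by positivity)]
        congr 1; ring
  refine le_trans ?_ hwi
  rw [eLpNorm_eq_lintegral_rpow_enorm_toReal (by simpa using hp0) (by simp),
    ENNReal.toReal_ofReal hp0.le, one_div, ENNReal.rpow_inv_le_iff hp0]
  exact (lintegral_mono fun x => ENNReal.rpow_le_rpow (hux x) hp0.le).trans hM

theorem global_decay_subcritical
    (N : ℕ) (α β : ℝ)
    (hα : 0 < α ∧ α < 1) (hβ : 0 < β ∧ β ≤ 1) (hN : 4 * β < (N : ℝ))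
    (G : EuclideanSpace ℝ (Fin N) → ℝ)
    (hGmeas : Measurable G) (hGnonneg : ∀ ξ, 0 ≤ G ξ)
    (c₁ c₂ : ℝ) (hc₁ : 0 < c₁) (hc₂ : 0 < c₂)
    (hGin : ∀ ξ : EuclideanSpace ℝ (Fin N), 0 < ‖ξ‖ → ‖ξ‖ ≤ 1 →
      c₁ * ‖ξ‖ ^ (4 * β - (N : ℝ)) ≤ G ξ ∧ G ξ ≤ c₂ * ‖ξ‖ ^ (4 * β - (N : ℝ)))
    (hGout : ∀ ξ : EuclideanSpace ℝ (Fin N), 1 ≤ ‖ξ‖ →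
      c₁ * ‖ξ‖ ^ (-((N : ℝ) + 2 * β)) ≤ G ξ ∧ G ξ ≤ c₂ * ‖ξ‖ ^ (-((N : ℝ) + 2 * β)))
    (Y : EuclideanSpace ℝ (Fin N) → ℝ → ℝ)
    (hY : ∀ x t, Y x t = t ^ (α - 1 - α * (N : ℝ) / (2 * β)) * G ((t ^ (-(α / (2 * β)))) • x))
    (f : EuclideanSpace ℝ (Fin N) → ℝ → ℝ)
    (hfmeas : Measurable (Function.uncurry f))
    (γ : ℝ) (C₀ : ℝ) (hC₀ : 0 < C₀)
    (hf1 : ∀ t : ℝ, 0 ≤ t →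
      eLpNorm (fun y => f y t) 1 volume ≤ ENNReal.ofReal (C₀ * (1 + t) ^ (-γ)))
    (u : EuclideanSpace ℝ (Fin N) → ℝ → ℝ)
    (hu : ∀ x t, u x t = ∫ s in Set.Ioc (0:ℝ) t, ∫ y, Y (x - y) (t - s) * f y s)
(p : ℝ) (hp1 : 1 ≤ p) (hpc : p < (N : ℝ) / ((N : ℝ) - 2 * β)) :
    ∃ C : ℝ, 0 < C ∧ ∀ t : ℝ, 2 ≤ t →
      (γ < 1 →
        eLpNorm (fun x => u x t) (ENNReal.ofReal p) volume ≤
          ENNReal.ofReal (C * t ^ (-γ + α - (α * (N : ℝ) / (2 * β)) * (1 - 1 / p)))) ∧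
      (γ = 1 →
        eLpNorm (fun x => u x t) (ENNReal.ofReal p) volume ≤
          ENNReal.ofReal (C * t ^ (-1 + α - (α * (N : ℝ) / (2 * β)) * (1 - 1 / p)) * Real.log t)) ∧
      (1 < γ →
        eLpNorm (fun x => u x t) (ENNReal.ofReal p) volume ≤
          ENNReal.ofReal (C * t ^ (-1 + α - (α * (N : ℝ) / (2 * β)) * (1 - 1 / p)))) := by
  obtain ⟨A, hA, hmain⟩ := aux_main N α β hα hβ hN G hGmeas hGnonneg c₂ hc₂
    (fun ξ h h' => (hGin ξ h h').2) (fun ξ h => (hGout ξ h).2) Y hY f hfmeas γ C₀ hC₀ hf1 u hu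
    p hp1 hpc
  obtain ⟨a, ha⟩ : ∃ a, a = α - 1 - (α * (N : ℝ) / (2 * β)) * (1 - 1 / p) := ⟨_, rfl⟩
  have ha1 : -1 < a := by
    obtain ⟨hα0, hα1⟩ := hα
    obtain ⟨hβ0, hβ1⟩ := hβ
    have hp0 : 0 < p := by linarith
    have hpc' : p * (N - 2 * β) < N := by rwa [lt_div_iff₀ (by linarith)] at hpc
    have : (α * (N : ℝ) / (2 * β)) * (1 - 1 / p) < α := by
      rw [show (α * (N : ℝ) / (2 * β)) * (1 - 1 / p) = α * (N * (p - 1)) / (2 * β * p) by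
        field_simp, div_lt_iff₀ (by positivity)]
      refine mul_lt_mul_of_pos_left ?_ hα0
      linarith
    linarith
  have e1 : -γ + α - (α * (N : ℝ) / (2 * β)) * (1 - 1 / p) = a + 1 - γ := by rw [ha]; ring
  have e2 : -1 + α - (α * (N : ℝ) / (2 * β)) * (1 - 1 / p) = a := by rw [ha]; ring
  rw [e1, e2]
  have hbd : ∀ t : ℝ, 2 ≤ t → ∀ J : ℝ, 0 ≤ J → ∫ x in (1:ℝ)..(1 + t), x ^ (-γ) ≤ J →
      eLpNorm (fun x => u x t) (ENNReal.ofReal p) volume ≤ ENNReal.ofReal (A *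
        (2 ^ |a| * t ^ a * J + 2 ^ |-γ| / (a + 1) * t ^ (a + 1 - γ))) := by
    intro t ht J hJ0 hJ
    refine (hmain t ht a ha).trans ?_
    rw [ENNReal.ofReal_mul hA.le]
    gcongr
    refine (aux_time a γ t J ha1 ht hJ hJ0).trans (le_of_eq ?_)
    congr 2
    rw [show a + 1 - γ = -γ + (a + 1) by ring, Real.rpow_add (by linarith) (-γ) (a + 1)]
    ring
  have ha2 : 0 < a + 1 := by linarith
  have h2a : (0:ℝ) < 2 ^ |a| := by positivity
  set B : ℝ := 2 ^ |-γ| / (a + 1) with hB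
  have hB0 : 0 < B := by positivity
  rcases lt_trichotomy γ 1 with hγ | hγ | hγ
  · have h1γ : 0 < 1 - γ := by linarith
    refine ⟨A * (2 ^ |a| * (2 ^ (1 - γ) / (1 - γ)) + B), by positivity, fun t ht =>
      ⟨fun _ => ?_, fun h => absurd h hγ.ne, fun h => absurd h hγ.not_gt⟩⟩
    have ht0 : 0 < t := by linarith
    refine (hbd t ht _ (by positivity) (aux_J1 γ t hγ ht)).trans (le_of_eq ?_)
    congr 1
    rw [show a + 1 - γ = a + (1 - γ) by ring, Real.rpow_add ht0]
    ring
  · refine ⟨A * (2 ^ |a| * 2 + B / Real.log 2), by have := Real.log_pos one_lt_two; positivity,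
      fun t ht => ⟨fun h => absurd hγ h.ne, fun _ => ?_, fun h => absurd hγ h.ne'⟩⟩
    have ht0 : 0 < t := by linarith
    have hl2 := Real.log_pos one_lt_two
    have hlt : Real.log 2 ≤ Real.log t := Real.log_le_log (by norm_num) ht
    refine (hbd t ht (2 * Real.log t) (by linarith) (by rw [hγ]; exact aux_J2 t ht)).trans ?_
    apply ENNReal.ofReal_le_ofReal
    rw [show a + 1 - γ = a by rw [hγ]; ring]
    have : B ≤ B / Real.log 2 * Real.log t := by
      rw [div_mul_eq_mul_div, le_div_iff₀ hl2]; gcongr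
    calc _ ≤ A * (2 ^ |a| * t ^ a * (2 * Real.log t) + (B / Real.log 2 * Real.log t) * t ^ a) := by
          gcongr
      _ = _ := by ring
  · have h1γ : 0 < γ - 1 := by linarith
    refine ⟨A * (2 ^ |a| * (1 / (γ - 1)) + B), by positivity, fun t ht =>
      ⟨fun h => absurd h hγ.not_gt, fun h => absurd h hγ.ne', fun _ => ?_⟩⟩
    have ht0 : 0 < t := by linarith
    refine (hbd t ht _ (by positivity) (aux_J3 γ t hγ ht)).trans ?_
    apply ENNReal.ofReal_le_ofReal
    have : t ^ (a + 1 - γ) ≤ t ^ a := Real.rpow_le_rpow_of_exponent_le (by linarith) (by linarith)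
    calc _ ≤ A * (2 ^ |a| * t ^ a * (1 / (γ - 1)) + B * t ^ a) := by gcongr
      _ = _ := by ring
end

section
/- Let p ∈ [p_c, ∞], γ ∈ ℝ, and suppose ‖f(·,t)‖_{L^1(ℝ^N)} ≤ C₀ (1+t)^{−γ} for all t ≥ 0 and in addition ‖f(·,t)‖_{L^q(ℝ^N)} ≤ C₀ (1+t)^{−γ} for all t ≥ 0, for some q > q_c(p) := N/(2β + N/p). Then for every compact set K ⊂ ℝ^N there is a constant C such that the mild solution u satisfies, for all t ≥ 2: ‖u(·,t)‖_{L^p(K)} ≤ C t^{−γ} if γ ≤ 1+α, and ‖u(·,t)‖_{L^p(K)} ≤ C t^{−(1+α)} if γ ≥ 1+α. -/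
open MeasureTheory Real Set Filter
open scoped ENNReal Pointwise
/-- Jensen / Minkowski type bound for weighted averages. -/
lemma aux_minkowski_s8 {X T : Type*} [MeasurableSpace X] [MeasurableSpace T]
    (μ : Measure X) (ν : Measure T) [SFinite μ] [SFinite ν] (p : ℝ≥0∞) (hp : 1 ≤ p)
    (w : T → ℝ≥0∞) (hw : Measurable w) (A : X → T → ℝ≥0∞)
    (hA : Measurable (Function.uncurry A)) (M : ℝ≥0∞)
    (hM : ∀ᵐ s ∂ν, eLpNorm (fun x => A x s) p μ ≤ M) :
    eLpNorm (fun x => ∫⁻ s, w s * A x s ∂ν) p μ ≤ (∫⁻ s, w s ∂ν) * M := by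
  by_cases hpt : p = ∞
  · subst hpt
    simp only [eLpNorm_exponent_top] at hM ⊢
    have h1 : ∀ᵐ s ∂ν, ∀ᵐ x ∂μ, A x s ≤ M := by
      filter_upwards [hM] with s hs
      filter_upwards [ae_le_eLpNormEssSup (f := fun x => A x s) (μ := μ)] with x hx
      exact le_trans (by simpa using hx) hs
    have h2 : ∀ᵐ x ∂μ, ∀ᵐ s ∂ν, A x s ≤ M :=
      (Measure.ae_ae_comm (p := fun x s => A x s ≤ M)
        (measurableSet_le (f := Function.uncurry A) hA measurable_const)).2 h1
    refine essSup_le_of_ae_le _ ?_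
    filter_upwards [h2] with x hx
    rw [enorm_eq_self, ← lintegral_mul_const _ hw]
    refine lintegral_mono_ae ?_
    filter_upwards [hx] with s hs
    gcongr
  · have hp0 : p ≠ 0 := (zero_lt_one.trans_le hp).ne'
    set P := p.toReal with hP
    have hP1 : 1 ≤ P := by
      have := ENNReal.toReal_mono hpt hp
      simpa using this
    have hP0 : 0 < P := by linarith
    set W := ∫⁻ s, w s ∂ν with hW
    have hM' : ∀ᵐ s ∂ν, ∫⁻ x, A x s ^ P ∂μ ≤ M ^ P := by
      filter_upwards [hM] with s hs
      rw [eLpNorm_eq_lintegral_rpow_enorm_toReal hp0 hpt] at hs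
      simp only [enorm_eq_self] at hs
      rw [← hP, one_div] at hs
      exact (ENNReal.rpow_inv_le_iff hP0).1 hs
    rw [eLpNorm_eq_lintegral_rpow_enorm_toReal hp0 hpt]
    simp only [enorm_eq_self]
    rw [← hP, one_div, ENNReal.rpow_inv_le_iff hP0, ENNReal.mul_rpow_of_nonneg _ _ hP0.le]
    have key : ∀ x, (∫⁻ s, w s * A x s ∂ν) ^ P ≤ W ^ (P - 1) * ∫⁻ s, w s * A x s ^ P ∂ν := by
      intro x
      have hAx : Measurable (fun s => A x s) := hA.comp measurable_prodMk_left
      have h := ENNReal.lintegral_mul_norm_pow_le (μ := ν) (f := fun s => w s * A x s ^ P) (g := w)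
        (by fun_prop) hw.aemeasurable (p := P⁻¹) (q := 1 - P⁻¹) (by positivity)
        (by have := inv_le_one_of_one_le₀ hP1; linarith) (by ring)
      have e : ∀ s, (w s * A x s ^ P) ^ P⁻¹ * w s ^ (1 - P⁻¹) = w s * A x s := by
        intro s
        rw [ENNReal.mul_rpow_of_nonneg _ _ (by positivity), ENNReal.rpow_rpow_inv hP0.ne',
          mul_right_comm, ← ENNReal.rpow_add_of_nonneg _ _ (by positivity)
          (by have := inv_le_one_of_one_le₀ hP1; linarith)]
        simp
      simp only [e] at h
      calc _ ≤ ((∫⁻ s, w s * A x s ^ P ∂ν) ^ P⁻¹ * W ^ (1 - P⁻¹)) ^ P :=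
            ENNReal.rpow_le_rpow h hP0.le
        _ = _ := by
            rw [ENNReal.mul_rpow_of_nonneg _ _ hP0.le, ENNReal.rpow_inv_rpow hP0.ne',
              ← ENNReal.rpow_mul, mul_comm]
            congr 2
            field_simp
    have hm2 : Measurable (Function.uncurry fun x s => w s * A x s ^ P) := by
      have : Measurable (fun z : X × T => w z.2 * (Function.uncurry A z) ^ P) := by fun_prop
      exact this
    calc _ ≤ ∫⁻ x, W ^ (P - 1) * ∫⁻ s, w s * A x s ^ P ∂ν ∂μ := lintegral_mono key
      _ = W ^ (P - 1) * ∫⁻ x, ∫⁻ s, w s * A x s ^ P ∂ν ∂μ := by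
          rw [lintegral_const_mul]
          exact hm2.lintegral_prod_right'
      _ = W ^ (P - 1) * ∫⁻ s, ∫⁻ x, w s * A x s ^ P ∂μ ∂ν := by
          rw [lintegral_lintegral_swap hm2.aemeasurable]
      _ = W ^ (P - 1) * ∫⁻ s, w s * ∫⁻ x, A x s ^ P ∂μ ∂ν := by
          congr 1
          refine lintegral_congr fun s => ?_
          rw [lintegral_const_mul]
          have : Measurable (fun x => A x s) := hA.comp measurable_prodMk_right
          fun_prop
      _ ≤ W ^ (P - 1) * ∫⁻ s, w s * M ^ P ∂ν := by
          gcongr 1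
          refine lintegral_mono_ae ?_
          filter_upwards [hM'] with s hs
          gcongr
      _ = W ^ P * M ^ P := by
          rw [lintegral_mul_const _ hw, ← mul_assoc, ← hW]
          congr 1
          nth_rewrite 2 [← ENNReal.rpow_one W]
          rw [← ENNReal.rpow_add_of_nonneg _ _ (by linarith) (by norm_num)]
          simp

/-- Young type inequality with an exponent between `1` and `q`. -/
lemma aux_young {E : Type*} [NormedAddCommGroup E] [MeasurableSpace E] [BorelSpace E]
    [SecondCountableTopology E]
    (μ : Measure E) [SFinite μ] [μ.IsAddHaarMeasure] [μ.IsNegInvariant] (p : ℝ≥0∞) (hp : 1 ≤ p) (q κ r : ℝ)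
    (hκ0 : 0 < κ) (hκ1 : κ ≤ 1) (hκq : q⁻¹ ≤ κ) (hq : 0 < q) (hκp : p.toReal⁻¹ ≤ κ)
    (hr0 : 0 < r) (hr : r⁻¹ = 1 + p.toReal⁻¹ - κ)
    (k : E → ℝ≥0∞) (hk : Measurable k) (hkr : ∫⁻ x, k x ^ r ∂μ ≠ ∞) :
    ∃ M : ℝ≥0∞, M ≠ ∞ ∧ ∀ g : E → ℝ≥0∞, Measurable g → ∫⁻ y, g y ∂μ ≤ 1 →
      ∫⁻ y, g y ^ q ∂μ ≤ 1 → eLpNorm (fun x => ∫⁻ y, k (x - y) * g y ∂μ) p μ ≤ M := by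
  set Kr := ∫⁻ x, k x ^ r ∂μ with hKr
  set ι := p.toReal⁻¹ with hι
  have hι0 : 0 ≤ ι := by positivity
  have hκ' : κ ≤ 1 := hκ1
  set D : ℝ≥0∞ := Kr ^ (1 - κ) * 2 ^ (κ - ι) with hD
  have hDt : D ≠ ∞ := ENNReal.mul_ne_top (ENNReal.rpow_ne_top_of_nonneg (by linarith) hkr)
    (ENNReal.rpow_ne_top_of_nonneg (by linarith) (by simp))
  clear_value D
  have hsh : ∀ x, ∫⁻ y, k (x - y) ^ r ∂μ = Kr := fun x =>
    lintegral_sub_left_eq_self (μ := μ) (fun z => k z ^ r) x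
  have hsh' : ∀ y, ∫⁻ x, k (x - y) ^ r ∂μ = Kr := fun y =>
    lintegral_sub_right_eq_self (μ := μ) (fun z => k z ^ r) y
  have hgq : ∀ g : E → ℝ≥0∞, Measurable g → ∫⁻ y, g y ∂μ ≤ 1 →
      ∫⁻ y, g y ^ q ∂μ ≤ 1 → ∫⁻ y, g y ^ κ⁻¹ ∂μ ≤ 2 := by
    intro g hg h1 h2
    calc _ ≤ ∫⁻ y, (g y + g y ^ q) ∂μ := by
          refine lintegral_mono fun y => ?_
          have a1 : 1 ≤ κ⁻¹ := (one_le_inv₀ hκ0).2 hκ1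
          have a2 : κ⁻¹ ≤ q := inv_le_of_inv_le₀ hq hκq
          rcases le_total (g y) 1 with h | h
          · refine le_add_of_le_left ?_
            calc g y ^ κ⁻¹ ≤ g y ^ (1:ℝ) := ENNReal.rpow_le_rpow_of_exponent_ge h a1
              _ = _ := ENNReal.rpow_one _
          · exact le_add_of_le_right (ENNReal.rpow_le_rpow_of_exponent_le h a2)
      _ = _ := lintegral_add_left hg _
      _ ≤ 1 + 1 := add_le_add h1 h2
      _ = 2 := by norm_num
  have main : ∀ g : E → ℝ≥0∞, Measurable g → ∫⁻ y, g y ∂μ ≤ 1 →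
      ∫⁻ y, g y ^ q ∂μ ≤ 1 → ∀ x, ∫⁻ y, k (x - y) * g y ∂μ ≤
        (∫⁻ y, k (x - y) ^ r * g y ^ κ⁻¹ ∂μ) ^ ι * D := by
    intro g hg h1 h2 x
    have h := ENNReal.lintegral_prod_norm_pow_le (μ := μ) (Finset.univ : Finset (Fin 3))
      (f := ![fun y => k (x - y) ^ r * g y ^ κ⁻¹, fun y => k (x - y) ^ r, fun y => g y ^ κ⁻¹])
      (p := ![ι, 1 - κ, κ - ι])
      (by
        intro i _
        fin_cases i
        · show AEMeasurable (fun y => k (x - y) ^ r * g y ^ κ⁻¹) μ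
          fun_prop
        · show AEMeasurable (fun y => k (x - y) ^ r) μ
          fun_prop
        · show AEMeasurable (fun y => g y ^ κ⁻¹) μ
          fun_prop)
      (by simp [Fin.sum_univ_three]; ring)
      (by
        intro i _
        fin_cases i
        · exact hι0
        · show 0 ≤ 1 - κ
          linarith
        · show 0 ≤ κ - ι
          linarith)
    simp only [Fin.prod_univ_three, Matrix.cons_val_zero, Matrix.cons_val_one,
      Matrix.cons_val] at h
    have e : ∀ y, (k (x - y) ^ r * g y ^ κ⁻¹) ^ ι * (k (x - y) ^ r) ^ (1 - κ) *
        (g y ^ κ⁻¹) ^ (κ - ι) = k (x - y) * g y := by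
      intro y
      have e1 : r * ι + r * (1 - κ) = 1 := by
        rw [← mul_add, show ι + (1 - κ) = r⁻¹ by rw [hr]; ring]
        exact mul_inv_cancel₀ hr0.ne'
      have e2 : κ⁻¹ * ι + κ⁻¹ * (κ - ι) = 1 := by
        rw [← mul_add]; field_simp; ring
      rw [ENNReal.mul_rpow_of_nonneg _ _ hι0, ← ENNReal.rpow_mul, ← ENNReal.rpow_mul,
        ← ENNReal.rpow_mul, ← ENNReal.rpow_mul, mul_right_comm (k (x - y) ^ (r * ι)),
        ← ENNReal.rpow_add_of_nonneg, e1, mul_assoc, ← ENNReal.rpow_add_of_nonneg, e2]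
      · simp
      · positivity
      · have : 0 ≤ κ - ι := by linarith
        positivity
      · positivity
      · have : 0 ≤ 1 - κ := by linarith
        positivity
    simp only [e, hsh] at h
    refine h.trans ?_
    rw [mul_assoc, hD]
    have := hgq g hg h1 h2
    have h3 : 0 ≤ κ - ι := by linarith
    gcongr
  by_cases hpt : p = ∞
  · subst hpt
    have hι' : ι = 0 := by simp [hι]
    refine ⟨D, hDt, fun g hg h1 h2 => ?_⟩
    rw [eLpNorm_exponent_top]
    refine essSup_le_of_ae_le _ (ae_of_all _ fun x => ?_)
    have := main g hg h1 h2 x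
    rw [hι', ENNReal.rpow_zero, one_mul] at this
    simpa using this
  · have hp0 : p ≠ 0 := (zero_lt_one.trans_le hp).ne'
    have hP0 : 0 < p.toReal := ENNReal.toReal_pos hp0 hpt
    refine ⟨(Kr * 2) ^ ι * D, ENNReal.mul_ne_top (ENNReal.rpow_ne_top_of_nonneg hι0
      (ENNReal.mul_ne_top hkr (by simp))) hDt, fun g hg h1 h2 => ?_⟩
    rw [eLpNorm_eq_lintegral_rpow_enorm_toReal hp0 hpt]
    simp only [enorm_eq_self]
    rw [one_div, ENNReal.rpow_inv_le_iff hP0]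
    have hm2 : Measurable (Function.uncurry fun x y => k (x - y) ^ r * g y ^ κ⁻¹) := by
      have : Measurable (fun z : E × E => k (z.1 - z.2) ^ r * (g z.2) ^ κ⁻¹) := by fun_prop
      exact this
    calc _ ≤ ∫⁻ x, (∫⁻ y, k (x - y) ^ r * g y ^ κ⁻¹ ∂μ) * D ^ p.toReal ∂μ := by
          refine lintegral_mono fun x => ?_
          refine (ENNReal.rpow_le_rpow (main g hg h1 h2 x) hP0.le).trans ?_
          rw [ENNReal.mul_rpow_of_nonneg _ _ hP0.le, hι, ENNReal.rpow_inv_rpow hP0.ne']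
      _ = (∫⁻ x, ∫⁻ y, k (x - y) ^ r * g y ^ κ⁻¹ ∂μ ∂μ) * D ^ p.toReal := by
          rw [lintegral_mul_const]
          exact hm2.lintegral_prod_right'
      _ = (∫⁻ y, ∫⁻ x, k (x - y) ^ r * g y ^ κ⁻¹ ∂μ ∂μ) * D ^ p.toReal := by
          rw [lintegral_lintegral_swap hm2.aemeasurable]
      _ = (∫⁻ y, Kr * g y ^ κ⁻¹ ∂μ) * D ^ p.toReal := by
          congr 1
          refine lintegral_congr fun y => ?_
          rw [lintegral_mul_const, hsh']
          fun_prop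
      _ = Kr * (∫⁻ y, g y ^ κ⁻¹ ∂μ) * D ^ p.toReal := by
          rw [lintegral_const_mul]
          fun_prop
      _ ≤ Kr * 2 * D ^ p.toReal := by
          gcongr
          exact hgq g hg h1 h2
      _ = _ := by
          have hPne : p.toReal ≠ 0 := ne_of_gt hP0
          rw [ENNReal.mul_rpow_of_nonneg _ _ hP0.le, hι, ENNReal.rpow_inv_rpow hPne]

/-- Local integrability of a negative power of the norm. -/
lemma aux_kernel_int (N : ℕ) (hN : 0 < N) (b r : ℝ) (hr : 0 < r) (hb : b * r < N) :
    ∫⁻ x : EuclideanSpace ℝ (Fin N),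
      (if ‖x‖ < 1 then ENNReal.ofReal (‖x‖ ^ (-b)) else 0) ^ r ≠ ∞ := by
  have : Nonempty (Fin N) := ⟨⟨0, hN⟩⟩
  have h : IntegrableOn (fun x : EuclideanSpace ℝ (Fin N) => (fun y : ℝ => y ^ (-(b * r))) ‖x‖)
      (Metric.ball 0 1) volume := by
    refine (integrableOn_fun_norm_addHaar volume (f := fun y : ℝ => y ^ (-(b * r)))).2 ?_
    have h1 : IntegrableOn (fun y : ℝ => y ^ ((N : ℝ) - 1 - b * r)) (Ioo 0 1) := by
      rw [intervalIntegral.integrableOn_Ioo_rpow_iff zero_lt_one]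
      linarith
    refine h1.congr_fun (fun y hy => ?_) measurableSet_Ioo
    have hy0 : 0 < y := hy.1
    simp only [finrank_euclideanSpace, Fintype.card_fin, smul_eq_mul]
    rw [← Real.rpow_natCast, ← Real.rpow_add hy0]
    congr 1
    rw [Nat.cast_sub (by omega)]
    push_cast
    ring
  have h2 := h.lintegral_lt_top
  refine ne_of_lt (lt_of_le_of_lt ?_ h2)
  rw [← lintegral_indicator measurableSet_ball]
  refine lintegral_mono fun x => ?_
  by_cases hx : ‖x‖ < 1
  · have : x ∈ Metric.ball (0 : EuclideanSpace ℝ (Fin N)) 1 := by simpa using hx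
    rw [indicator_of_mem this, if_pos hx]
    rw [ENNReal.ofReal_rpow_of_nonneg (by positivity) hr.le, ← Real.rpow_mul (norm_nonneg _)]
    simp
  · simp [hx, hr]

/-- Pointwise bound for the kernel. -/
lemma aux_kernel_bound (N : ℕ) (α β : ℝ) (hβ : 0 < β) (hN : 4 * β < (N : ℝ))
    (G : EuclideanSpace ℝ (Fin N) → ℝ) (c₂ : ℝ) (hc₂ : 0 < c₂)
    (hGin : ∀ ξ : EuclideanSpace ℝ (Fin N), 0 < ‖ξ‖ → ‖ξ‖ ≤ 1 →
      G ξ ≤ c₂ * ‖ξ‖ ^ (4 * β - (N : ℝ)))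
    (hGout : ∀ ξ : EuclideanSpace ℝ (Fin N), 1 ≤ ‖ξ‖ →
      G ξ ≤ c₂ * ‖ξ‖ ^ (-((N : ℝ) + 2 * β)))
    (b : ℝ) (hb1 : N - 4 * β ≤ b) (hb2 : b ≤ N + 2 * β)
    (x : EuclideanSpace ℝ (Fin N)) (hx : x ≠ 0) (τ : ℝ) (hτ : 0 < τ) :
    τ ^ (α - 1 - α * (N : ℝ) / (2 * β)) * G ((τ ^ (-(α / (2 * β)))) • x) ≤
      c₂ * (if τ < 1 then τ ^ (α - 1 - α / (2 * β) * (N - b)) else τ ^ (-(1 + α))) *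
        ((if ‖x‖ < 1 then ‖x‖ ^ (-b) else 0) + 1) := by
  have hxn : 0 < ‖x‖ := norm_pos_iff.2 hx
  have hG : ∀ a : ℝ, N - 4 * β ≤ a → a ≤ N + 2 * β → ∀ ξ : EuclideanSpace ℝ (Fin N), ξ ≠ 0 →
      G ξ ≤ c₂ * ‖ξ‖ ^ (-a) := by
    intro a ha1 ha2 ξ hξ
    have hξn : 0 < ‖ξ‖ := norm_pos_iff.2 hξ
    rcases le_total ‖ξ‖ 1 with h | h
    · refine (hGin ξ hξn h).trans ?_
      have := Real.rpow_le_rpow_of_exponent_ge hξn h (show -a ≤ 4 * β - N by linarith)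
      gcongr
    · refine (hGout ξ h).trans ?_
      have := Real.rpow_le_rpow_of_exponent_le h (show -((N : ℝ) + 2 * β) ≤ -a by linarith)
      gcongr
  have hY : ∀ a : ℝ, N - 4 * β ≤ a → a ≤ N + 2 * β →
      τ ^ (α - 1 - α * (N : ℝ) / (2 * β)) * G ((τ ^ (-(α / (2 * β)))) • x) ≤
        c₂ * τ ^ (α - 1 - α / (2 * β) * (N - a)) * ‖x‖ ^ (-a) := by
    intro a ha1 ha2
    have hne : (τ ^ (-(α / (2 * β)))) • x ≠ 0 := smul_ne_zero (by positivity) hx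
    calc _ ≤ τ ^ (α - 1 - α * (N : ℝ) / (2 * β)) *
          (c₂ * ‖(τ ^ (-(α / (2 * β)))) • x‖ ^ (-a)) := by
          have := hG a ha1 ha2 _ hne
          gcongr
      _ = _ := by
          rw [norm_smul, Real.norm_of_nonneg (by positivity), Real.mul_rpow (by positivity)
            (by positivity), ← Real.rpow_mul hτ.le]
          rw [show α - 1 - α / (2 * β) * (N - a) = (α - 1 - α * (N : ℝ) / (2 * β)) +
            (-(α / (2 * β)) * -a) by ring, Real.rpow_add hτ]
          ring
  have hsmall : ∀ a : ℝ, 0 ≤ a → a ≤ b →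
      ‖x‖ ^ (-a) ≤ (if ‖x‖ < 1 then ‖x‖ ^ (-b) else 0) + 1 := by
    intro a ha hab
    split_ifs with h
    · have := Real.rpow_le_rpow_of_exponent_ge hxn h.le (show -b ≤ -a by linarith)
      linarith
    · have := Real.rpow_le_one_of_one_le_of_nonpos (not_lt.1 h) (show -a ≤ 0 by linarith)
      linarith
  by_cases h : τ < 1
  · rw [if_pos h]
    refine (hY b hb1 hb2).trans ?_
    have := hsmall b (by linarith) le_rfl
    gcongr
  · rw [if_neg h]
    refine (hY (N - 4 * β) le_rfl (by linarith)).trans ?_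
    have := hsmall (N - 4 * β) (by linarith) hb1
    rw [show α - 1 - α / (2 * β) * (N - (N - 4 * β)) = -(1 + α) by field_simp; ring]
    gcongr

/-- Pointwise bound for the time weights. -/
lemma aux_time_pt (α γ m σ : ℝ) (hm : m ≤ 1 + α) (hmγ : m ≤ γ)
    (t s : ℝ) (ht : 2 ≤ t) (hs0 : 0 < s) (hst : s < t) :
    (if t - s < 1 then (t - s) ^ (σ - 1) else (t - s) ^ (-(1 + α))) * (1 + s) ^ (-γ) ≤
      2 ^ |m| * t ^ (-m) * ((if t - s < 1 then (t - s) ^ (σ - 1) else (t - s) ^ (-(1 + α)))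
        + (1 + s) ^ (-(1 + α))) := by
  set h := (if t - s < 1 then (t - s) ^ (σ - 1) else (t - s) ^ (-(1 + α))) with hh
  have hτ : 0 < t - s := by linarith
  have h0 : 0 < h := by rw [hh]; split_ifs <;> positivity
  have ht0 : 0 < t := by linarith
  have h1 : (1 + s) ^ (-γ) ≤ (1 + s) ^ (-m) :=
    Real.rpow_le_rpow_of_exponent_le (by linarith) (by linarith)
  have hs1 : 0 < (1 + s) ^ (-(1 + α)) := by positivity
  have two1 : (1:ℝ) ≤ 2 ^ |m| := Real.one_le_rpow (by norm_num) (abs_nonneg _)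
  have easy : (1 + s) ^ (-m) ≤ 2 ^ |m| * t ^ (-m) →
      h * (1 + s) ^ (-γ) ≤ 2 ^ |m| * t ^ (-m) * (h + (1 + s) ^ (-(1 + α))) := by
    intro h2
    calc h * (1 + s) ^ (-γ) ≤ h * (2 ^ |m| * t ^ (-m)) := by gcongr; exact h1.trans h2
      _ = 2 ^ |m| * t ^ (-m) * h := by ring
      _ ≤ _ := by gcongr; linarith
  rcases le_total m 0 with hm0 | hm0
  · apply easy
    have : (1 + s) ^ (-m) ≤ (2 * t) ^ (-m) :=
      Real.rpow_le_rpow (by linarith) (by linarith) (by linarith)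
    rw [Real.mul_rpow (by norm_num) ht0.le] at this
    rwa [abs_of_nonpos hm0]
  · have habs : |m| = m := abs_of_nonneg hm0
    have hhalf : (t / 2) ^ (-m) = 2 ^ |m| * t ^ (-m) := by
      rw [habs, Real.div_rpow ht0.le (by norm_num), Real.rpow_neg (by norm_num : (0:ℝ) ≤ 2)]
      field_simp
    by_cases hc : t / 2 ≤ 1 + s
    · apply easy
      rw [← hhalf]
      exact Real.rpow_le_rpow_of_nonpos (by linarith) hc (by linarith)
    · have hτ1 : ¬ (t - s < 1) := by linarith
      have hτ2 : 1 + s ≤ t - s := by linarith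
      have hτ3 : t / 2 ≤ t - s := by linarith
      have hhe : h = (t - s) ^ (-(1 + α)) := by rw [hh, if_neg hτ1]
      have a1 : (t - s) ^ (-m) ≤ 2 ^ |m| * t ^ (-m) := by
        rw [← hhalf]
        exact Real.rpow_le_rpow_of_nonpos (by linarith) hτ3 (by linarith)
      have a2 : (t - s) ^ (m - (1 + α)) ≤ (1 + s) ^ (m - (1 + α)) :=
        Real.rpow_le_rpow_of_nonpos (by linarith) hτ2 (by linarith)
      calc h * (1 + s) ^ (-γ) ≤ h * (1 + s) ^ (-m) := by gcongr
        _ = (t - s) ^ (-m) * (t - s) ^ (m - (1 + α)) * (1 + s) ^ (-m) := by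
            rw [hhe, ← Real.rpow_add hτ]; congr 2; ring
        _ ≤ (2 ^ |m| * t ^ (-m)) * (1 + s) ^ (m - (1 + α)) * (1 + s) ^ (-m) := by gcongr
        _ = (2 ^ |m| * t ^ (-m)) * (1 + s) ^ (-(1 + α)) := by
            rw [mul_assoc, ← Real.rpow_add (by linarith)]; congr 2; ring
        _ ≤ _ := by gcongr; linarith

/-- The time convolution bound. -/
lemma aux_time_s8 (α γ m σ : ℝ) (hα : 0 < α) (hσ : 0 < σ) (hm : m ≤ 1 + α) (hmγ : m ≤ γ) :
    ∃ W : ℝ, 0 < W ∧ ∀ t : ℝ, 2 ≤ t →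
      ∫⁻ s in Ioo 0 t, ENNReal.ofReal
        ((if t - s < 1 then (t - s) ^ (σ - 1) else (t - s) ^ (-(1 + α))) * (1 + s) ^ (-γ))
        ≤ ENNReal.ofReal (W * t ^ (-m)) := by
  set h : ℝ → ℝ := fun τ => if τ < 1 then τ ^ (σ - 1) else τ ^ (-(1 + α)) with hh
  have hmeas : Measurable h := by
    rw [hh]
    exact Measurable.ite measurableSet_Iio (by fun_prop) (by fun_prop)
  have hint : ∫⁻ τ in Ioi 0, ENNReal.ofReal (h τ) ≠ ∞ := by
    have e : Ioi (0:ℝ) = Ioo 0 1 ∪ Ici 1 := (Ioo_union_Ici_eq_Ioi zero_lt_one).symm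
    have i1 : IntegrableOn h (Ioo 0 1) := by
      have : IntegrableOn (fun τ : ℝ => τ ^ (σ - 1)) (Ioo 0 1) := by
        rw [intervalIntegral.integrableOn_Ioo_rpow_iff zero_lt_one]; linarith
      refine this.congr_fun (fun y hy => ?_) measurableSet_Ioo
      simp [hh, hy.2]
    have i2 : IntegrableOn h (Ici 1) := by
      rw [integrableOn_Ici_iff_integrableOn_Ioi]
      have : IntegrableOn (fun τ : ℝ => τ ^ (-(1 + α))) (Ioi 1) :=
        integrableOn_Ioi_rpow_of_lt (by linarith) zero_lt_one
      refine this.congr_fun (fun y hy => ?_) measurableSet_Ioi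
      have hy1 : (1:ℝ) < y := hy
      simp [hh, not_lt.2 hy1.le]
    have i3 : IntegrableOn h (Ioi 0) := by rw [e]; exact i1.union i2
    exact i3.lintegral_lt_top.ne
  have hint2 : ∫⁻ s in Ioi (0:ℝ), ENNReal.ofReal ((1 + s) ^ (-(1 + α))) ≠ ∞ := by
    have := integrableOn_add_rpow_Ioi_of_lt (a := -(1 + α)) (c := 0) (m := 1) (by linarith)
      (by norm_num)
    have i : IntegrableOn (fun s : ℝ => (1 + s) ^ (-(1 + α))) (Ioi 0) := by
      simpa [add_comm] using this
    exact i.lintegral_lt_top.ne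
  set J := ∫⁻ τ in Ioi 0, ENNReal.ofReal (h τ) with hJ
  set J2 := ∫⁻ s in Ioi (0:ℝ), ENNReal.ofReal ((1 + s) ^ (-(1 + α))) with hJ2
  refine ⟨2 ^ |m| * ((J + J2).toReal + 1), by positivity, fun t ht => ?_⟩
  have ht0 : 0 < t := by linarith
  have step : ∫⁻ s in Ioo 0 t, ENNReal.ofReal (h (t - s)) ≤ J := by
    rw [hJ, ← lintegral_indicator measurableSet_Ioo, ← lintegral_indicator measurableSet_Ioi,
      ← lintegral_sub_left_eq_self (μ := volume)
        ((Ioi (0:ℝ)).indicator fun τ => ENNReal.ofReal (h τ)) t]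
    refine lintegral_mono fun s => ?_
    by_cases hs : s ∈ Ioo 0 t
    · rw [indicator_of_mem hs, indicator_of_mem (by simpa using hs.2)]
    · rw [indicator_of_notMem hs]; exact zero_le
  have step2 : ∫⁻ s in Ioo 0 t, ENNReal.ofReal ((1 + s) ^ (-(1 + α))) ≤ J2 :=
    lintegral_mono_set Ioo_subset_Ioi_self
  calc _ ≤ ∫⁻ s in Ioo 0 t, ENNReal.ofReal (2 ^ |m| * t ^ (-m)) *
        (ENNReal.ofReal (h (t - s)) + ENNReal.ofReal ((1 + s) ^ (-(1 + α)))) := by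
        refine setLIntegral_mono' measurableSet_Ioo fun s hs => ?_
        have hτ : 0 < t - s := by linarith [hs.2]
        have hs0 := hs.1
        have h0 : 0 ≤ h (t - s) := by simp only [hh]; split_ifs <;> positivity
        rw [← ENNReal.ofReal_add h0 (by positivity), ← ENNReal.ofReal_mul (by positivity)]
        exact ENNReal.ofReal_le_ofReal (aux_time_pt α γ m σ hm hmγ t s ht hs.1 hs.2)
    _ = ENNReal.ofReal (2 ^ |m| * t ^ (-m)) * ((∫⁻ s in Ioo 0 t, ENNReal.ofReal (h (t - s))) +
        ∫⁻ s in Ioo 0 t, ENNReal.ofReal ((1 + s) ^ (-(1 + α)))) := by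
        rw [lintegral_const_mul, lintegral_add_left]
        · fun_prop
        · fun_prop
    _ ≤ ENNReal.ofReal (2 ^ |m| * t ^ (-m)) * (J + J2) := by gcongr
    _ = ENNReal.ofReal (2 ^ |m| * t ^ (-m)) * ENNReal.ofReal (J + J2).toReal := by
        rw [ENNReal.ofReal_toReal]; simp [hint, hint2]
    _ ≤ _ := by
        rw [← ENNReal.ofReal_mul (by positivity)]
        apply ENNReal.ofReal_le_ofReal
        have : 0 < 2 ^ |m| * t ^ (-m) := by positivity
        nlinarith

theorem compact_sets_decay_supercritical
    (N : ℕ) (α β : ℝ)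
    (hα : 0 < α ∧ α < 1) (hβ : 0 < β ∧ β ≤ 1) (hN : 4 * β < (N : ℝ))
    (G : EuclideanSpace ℝ (Fin N) → ℝ)
    (hGmeas : Measurable G) (hGnonneg : ∀ ξ, 0 ≤ G ξ)
    (c₁ c₂ : ℝ) (hc₁ : 0 < c₁) (hc₂ : 0 < c₂)
    (hGin : ∀ ξ : EuclideanSpace ℝ (Fin N), 0 < ‖ξ‖ → ‖ξ‖ ≤ 1 →
      c₁ * ‖ξ‖ ^ (4 * β - (N : ℝ)) ≤ G ξ ∧ G ξ ≤ c₂ * ‖ξ‖ ^ (4 * β - (N : ℝ)))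
    (hGout : ∀ ξ : EuclideanSpace ℝ (Fin N), 1 ≤ ‖ξ‖ →
      c₁ * ‖ξ‖ ^ (-((N : ℝ) + 2 * β)) ≤ G ξ ∧ G ξ ≤ c₂ * ‖ξ‖ ^ (-((N : ℝ) + 2 * β)))
    (Y : EuclideanSpace ℝ (Fin N) → ℝ → ℝ)
    (hY : ∀ x t, Y x t = t ^ (α - 1 - α * (N : ℝ) / (2 * β)) * G ((t ^ (-(α / (2 * β)))) • x))
    (f : EuclideanSpace ℝ (Fin N) → ℝ → ℝ)
    (hfmeas : Measurable (Function.uncurry f))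
    (γ : ℝ) (C₀ : ℝ) (hC₀ : 0 < C₀)
    (hf1 : ∀ t : ℝ, 0 ≤ t →
      eLpNorm (fun y => f y t) 1 volume ≤ ENNReal.ofReal (C₀ * (1 + t) ^ (-γ)))
    (u : EuclideanSpace ℝ (Fin N) → ℝ → ℝ)
    (hu : ∀ x t, u x t = ∫ s in Set.Ioc (0:ℝ) t, ∫ y, Y (x - y) (t - s) * f y s)
    (p : ℝ≥0∞) (hp : ENNReal.ofReal ((N : ℝ) / ((N : ℝ) - 2 * β)) ≤ p)
    (q : ℝ) (hq : q > (N : ℝ) / (2 * β + (N : ℝ) / p.toReal))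
    (hfq : ∀ t : ℝ, 0 ≤ t →
      eLpNorm (fun y => f y t) (ENNReal.ofReal q) volume ≤ ENNReal.ofReal (C₀ * (1 + t) ^ (-γ)))
    (K : Set (EuclideanSpace ℝ (Fin N))) (hK : IsCompact K) :
    ∃ C : ℝ, 0 < C ∧ ∀ t : ℝ, 2 ≤ t →
      (γ ≤ 1 + α →
        eLpNorm (fun x => u x t) p (volume.restrict K) ≤ ENNReal.ofReal (C * t ^ (-γ))) ∧
      (1 + α ≤ γ →
        eLpNorm (fun x => u x t) p (volume.restrict K) ≤ ENNReal.ofReal (C * t ^ (-(1 + α)))) := by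
  obtain ⟨hα0, hα1⟩ := hα
  obtain ⟨hβ0, hβ1⟩ := hβ
  have hN0 : (0:ℝ) < N := by linarith
  have hN2 : (0:ℝ) < N - 2 * β := by linarith
  have hNn : 0 < N := by exact_mod_cast hN0
  have : Nonempty (Fin N) := ⟨⟨0, hNn⟩⟩
  have hp1 : 1 ≤ p := by
    refine le_trans ?_ hp
    rw [ENNReal.one_le_ofReal, le_div_iff₀ hN2]
    linarith
  set ι := p.toReal⁻¹ with hι
  have hι0 : 0 ≤ ι := by positivity
  have hι1 : ι ≤ (N - 2 * β) / N := by
    by_cases hpt : p = ∞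
    · simp only [hι, hpt, ENNReal.toReal_top, inv_zero]
      positivity
    · have := (ENNReal.ofReal_le_iff_le_toReal hpt).1 hp
      rw [hι, ← inv_div]
      exact inv_anti₀ (by positivity) this
  rw [div_eq_mul_inv (N : ℝ) p.toReal, ← hι] at hq
  have hden : 0 < 2 * β + N * ι := by positivity
  have hq1 : 1 < q := by
    refine lt_of_le_of_lt ?_ hq
    rw [le_div_iff₀ hden]
    rw [le_div_iff₀ hN0] at hι1
    linarith
  have hq0 : 0 < q := by linarith
  have hqi : q⁻¹ < 2 * β / N + ι := by
    rw [inv_lt_iff_one_lt_mul₀ hq0]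
    rw [gt_iff_lt, div_lt_iff₀ hden] at hq
    have : (2 * β / N + ι) * q = (q * (2 * β + N * ι)) / N := by field_simp
    rw [mul_comm, mul_comm q, this, lt_div_iff₀ hN0]
    linarith
  have hι2 : ι < 1 := by
    refine lt_of_le_of_lt hι1 ?_
    rw [div_lt_one hN0]; linarith
  obtain ⟨κ, hκ⟩ : ∃ κ, κ = max q⁻¹ ι := ⟨_, rfl⟩
  have hκ0 : 0 < κ := by rw [hκ]; exact lt_max_of_lt_left (by positivity)
  have hκ1 : κ < 1 := by rw [hκ]; exact max_lt (inv_lt_one_of_one_lt₀ hq1) hι2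
  have hκq : q⁻¹ ≤ κ := by rw [hκ]; exact le_max_left _ _
  have hκι : ι ≤ κ := by rw [hκ]; exact le_max_right _ _
  have hκ2 : κ < 2 * β / N + ι := by
    rw [hκ]; exact max_lt hqi (by have : 0 < 2 * β / N := by positivity
                                  linarith)
  obtain ⟨ρ, hρ⟩ : ∃ ρ, ρ = 1 + ι - κ := ⟨_, rfl⟩
  have hρ0 : 0 < ρ := by linarith
  have hρ1 : ρ ≤ 1 := by linarith
  have hρN : N - 2 * β < N * ρ := by
    have : N * κ < N * (2 * β / N + ι) := by gcongr
    have e : N * (2 * β / N + ι) = 2 * β + N * ι := by field_simp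
    rw [hρ]; linarith
  have hρN1 : N * ρ ≤ N := by nlinarith
  obtain ⟨b, hb⟩ : ∃ b, b = (N - 2 * β + N * ρ) / 2 := ⟨_, rfl⟩
  have hb1 : N - 2 * β < b := by linarith
  have hb2 : b < N * ρ := by linarith
  obtain ⟨σ, hσ⟩ : ∃ σ, σ = α - α / (2 * β) * (N - b) := ⟨_, rfl⟩
  have hσ0 : 0 < σ := by
    have : α / (2 * β) * (N - b) < α / (2 * β) * (2 * β) := by gcongr; linarith
    have e : α / (2 * β) * (2 * β) = α := by field_simp
    linarith
  -- the spatial kernel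
  obtain ⟨k, hk⟩ : ∃ k : EuclideanSpace ℝ (Fin N) → ℝ≥0∞, k = fun x =>
    if ‖x‖ < 1 then ENNReal.ofReal (‖x‖ ^ (-b)) else 0 := ⟨_, rfl⟩
  have hkm : Measurable k := by
    rw [hk]
    exact Measurable.ite (measurableSet_lt measurable_norm measurable_const) (by fun_prop)
      measurable_const
  have hkr : ∫⁻ x, k x ^ ρ⁻¹ ≠ ∞ := by
    rw [hk]
    refine aux_kernel_int N hNn b ρ⁻¹ (by positivity) ?_
    rw [← div_eq_mul_inv, div_lt_iff₀ hρ0]; exact hb2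
  obtain ⟨M, hMt, hM⟩ := aux_young (volume : Measure (EuclideanSpace ℝ (Fin N))) p hp1 q κ ρ⁻¹
    hκ0 hκ1.le hκq hq0 hκι (by positivity) (by rw [inv_inv, hρ]) k hkm hkr
  -- the time weights
  obtain ⟨m, hm⟩ : ∃ m, m = min γ (1 + α) := ⟨_, rfl⟩
  obtain ⟨W, hW0, hW⟩ := aux_time_s8 α γ m σ hα0 hσ0 (by rw [hm]; exact min_le_right _ _)
    (by rw [hm]; exact min_le_left _ _)
  have hKfin : IsFiniteMeasure (volume.restrict K) :=
    ⟨by rw [Measure.restrict_apply_univ]; exact hK.measure_lt_top⟩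
  obtain ⟨M2, hM2⟩ : ∃ M2 : ℝ≥0∞, M2 = eLpNorm (fun _ : EuclideanSpace ℝ (Fin N) => (1 : ℝ≥0∞)) p
    (volume.restrict K) := ⟨_, rfl⟩
  have hM2t : M2 ≠ ∞ := by
    rw [hM2]
    exact (memLp_const_enorm (by simp)).2.ne
  have main : ∀ t : ℝ, 2 ≤ t → eLpNorm (fun x => u x t) p (volume.restrict K) ≤
      ENNReal.ofReal (c₂ * C₀ * W * ((M + M2).toReal + 1) * t ^ (-m)) := by
    intro t ht
    obtain ⟨h, hh⟩ : ∃ h : ℝ → ℝ, h = fun τ =>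
      if τ < 1 then τ ^ (σ - 1) else τ ^ (-(1 + α)) := ⟨_, rfl⟩
    have hhm : Measurable h := by
      rw [hh]
      exact Measurable.ite measurableSet_Iio (by fun_prop) (by fun_prop)
    have hhpos : ∀ τ, 0 < τ → 0 < h τ := by
      intro τ hτ
      rw [hh]; dsimp only
      split_ifs <;> positivity
    obtain ⟨B, hB⟩ : ∃ B : ℝ → ℝ, B = fun s => C₀ * (1 + s) ^ (-γ) := ⟨_, rfl⟩
    have hBm : Measurable B := by rw [hB]; fun_prop
    have hBpos : ∀ s, 0 < s → 0 < B s := by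
      intro s hs
      rw [hB]; positivity
    obtain ⟨F, hF⟩ : ∃ F : ℝ → EuclideanSpace ℝ (Fin N) → ℝ≥0∞,
      F = fun s y => ‖f y s‖ₑ * (ENNReal.ofReal (B s))⁻¹ := ⟨_, rfl⟩
    have hfm' : Measurable (fun z : ℝ × EuclideanSpace ℝ (Fin N) => f z.2 z.1) :=
      hfmeas.comp measurable_swap
    have hFm : Measurable (fun z : ℝ × EuclideanSpace ℝ (Fin N) => F z.1 z.2) := by
      rw [hF]
      exact hfm'.enorm.mul (by fun_prop)
    have hFs : ∀ s, Measurable (F s) := fun s => hFm.comp measurable_prodMk_left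
    have hfs : ∀ s, Measurable (fun y => f y s) := fun s => hfmeas.comp measurable_prodMk_right
    have hF1 : ∀ s, 0 < s → ∫⁻ y, F s y ≤ 1 := by
      intro s hs
      have h1 := hf1 s hs.le
      rw [eLpNorm_one_eq_lintegral_enorm] at h1
      have hBs := hBpos s hs
      have hBe : C₀ * (1 + s) ^ (-γ) = B s := by rw [hB]
      rw [hBe] at h1
      simp only [hF]
      rw [lintegral_mul_const _ (hfs s).enorm]
      calc _ ≤ ENNReal.ofReal (B s) * (ENNReal.ofReal (B s))⁻¹ := by gcongr
        _ ≤ 1 := ENNReal.mul_inv_le_one _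
    have hFq : ∀ s, 0 < s → ∫⁻ y, F s y ^ q ≤ 1 := by
      intro s hs
      have h1 := hfq s hs.le
      have hBs := hBpos s hs
      have hBe : C₀ * (1 + s) ^ (-γ) = B s := by rw [hB]
      rw [hBe, eLpNorm_eq_lintegral_rpow_enorm_toReal (by simpa using hq0) (by simp),
        ENNReal.toReal_ofReal hq0.le, one_div, ENNReal.rpow_inv_le_iff hq0] at h1
      simp only [hF, ENNReal.mul_rpow_of_nonneg _ _ hq0.le]
      rw [lintegral_mul_const _ ((hfs s).enorm.pow_const q)]
      calc _ ≤ ENNReal.ofReal (B s) ^ q * (ENNReal.ofReal (B s))⁻¹ ^ q := by gcongr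
        _ = (ENNReal.ofReal (B s) * (ENNReal.ofReal (B s))⁻¹) ^ q := by
            rw [ENNReal.mul_rpow_of_nonneg _ _ hq0.le]
        _ ≤ 1 := ENNReal.rpow_le_one (ENNReal.mul_inv_le_one _) hq0.le
    obtain ⟨A, hA⟩ : ∃ A : EuclideanSpace ℝ (Fin N) → ℝ → ℝ≥0∞,
      A = fun x s => (∫⁻ y, k (x - y) * F s y) + 1 := ⟨_, rfl⟩
    have hconv : Measurable (fun z : EuclideanSpace ℝ (Fin N) × ℝ =>
        ∫⁻ y, k (z.1 - y) * F z.2 y) := by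
      have : Measurable (fun v : (EuclideanSpace ℝ (Fin N) × ℝ) × EuclideanSpace ℝ (Fin N) =>
          k (v.1.1 - v.2) * F v.1.2 v.2) := by
        have h1 : Measurable (fun v : (EuclideanSpace ℝ (Fin N) × ℝ) × EuclideanSpace ℝ (Fin N) =>
          F v.1.2 v.2) := hFm.comp (g := fun z : ℝ × EuclideanSpace ℝ (Fin N) => F z.1 z.2)
            (f := fun v : (EuclideanSpace ℝ (Fin N) × ℝ) × EuclideanSpace ℝ (Fin N) =>
              (v.1.2, v.2)) (by fun_prop)
        exact (hkm.comp (by fun_prop)).mul h1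
      exact this.lintegral_prod_right'
    have hAm : Measurable (Function.uncurry A) := by
      have : Function.uncurry A = fun z : EuclideanSpace ℝ (Fin N) × ℝ =>
        (∫⁻ y, k (z.1 - y) * F z.2 y) + 1 := by rw [hA]; rfl
      rw [this]
      exact hconv.add_const 1
    have hAM : ∀ᵐ s ∂(volume.restrict (Ioo 0 t)),
        eLpNorm (fun x => A x s) p (volume.restrict K) ≤ M + M2 := by
      refine ae_restrict_of_forall_mem measurableSet_Ioo fun s hs => ?_
      have e : (fun x => A x s) = (fun x => ∫⁻ y, k (x - y) * F s y) + fun _ => 1 := by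
        rw [hA]; rfl
      have hm1 : Measurable (fun x => ∫⁻ y, k (x - y) * F s y) :=
        hconv.comp (measurable_prodMk_right (y := s))
      rw [e]
      refine (eLpNorm_add_le hm1.aestronglyMeasurable
        measurable_const.aestronglyMeasurable hp1).trans ?_
      rw [← hM2]
      gcongr
      exact (eLpNorm_mono_measure _ Measure.restrict_le_self).trans
        (hM (F s) (hFs s) (hF1 s hs.1) (hFq s hs.1))
    obtain ⟨w, hw⟩ : ∃ w : ℝ → ℝ≥0∞, w = fun s =>
      ENNReal.ofReal (c₂ * C₀) * ENNReal.ofReal (h (t - s) * (1 + s) ^ (-γ)) := ⟨_, rfl⟩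
    have hwm : Measurable w := by rw [hw]; fun_prop
    have hbound : ∀ x, ‖u x t‖ₑ ≤ ∫⁻ s in Ioo 0 t, w s * A x s := by
      intro x
      rw [hu]
      refine (enorm_integral_le_lintegral_enorm _).trans ?_
      rw [← setLIntegral_congr (Ioo_ae_eq_Ioc (μ := volume) (a := (0:ℝ)) (b := t))]
      refine setLIntegral_mono' measurableSet_Ioo fun s hs => ?_
      refine (enorm_integral_le_lintegral_enorm _).trans ?_
      have hs0 := hs.1
      have hτ : 0 < t - s := by linarith [hs.2]
      have hBs := hBpos s hs0
      have hhs := hhpos _ hτ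
      have hne : ∀ᵐ y : EuclideanSpace ℝ (Fin N), x - y ≠ 0 := by
        have : ∀ᵐ y : EuclideanSpace ℝ (Fin N), y ≠ x := by
          simp [ae_iff]
        filter_upwards [this] with y hy
        exact sub_ne_zero.2 hy.symm
      have hwe : w s = ENNReal.ofReal (c₂ * h (t - s)) * ENNReal.ofReal (B s) := by
        rw [hw, hB]
        dsimp only
        rw [← ENNReal.ofReal_mul (by positivity), ← ENNReal.ofReal_mul (by positivity)]
        congr 1; ring
      calc ∫⁻ y, ‖Y (x - y) (t - s) * f y s‖ₑ
          ≤ ∫⁻ y, w s * (k (x - y) * F s y + F s y) := by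
            refine lintegral_mono_ae ?_
            filter_upwards [hne] with y hy
            rw [enorm_mul]
            have hY0 : 0 ≤ Y (x - y) (t - s) := by
              rw [hY]
              exact mul_nonneg (by positivity) (hGnonneg _)
            have hYb : Y (x - y) (t - s) ≤ c₂ * h (t - s) *
                ((if ‖x - y‖ < 1 then ‖x - y‖ ^ (-b) else 0) + 1) := by
              rw [hY]
              refine (aux_kernel_bound N α β hβ0 hN G c₂ hc₂ (fun ξ h1 h2 => (hGin ξ h1 h2).2)
                (fun ξ h1 => (hGout ξ h1).2) b (by linarith) (by linarith) (x - y) hy (t - s)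
                hτ).trans (le_of_eq ?_)
              rw [hh]
              dsimp only
              rw [show α - 1 - α / (2 * β) * (N - b) = σ - 1 by rw [hσ]; ring]
            have hYe : ‖Y (x - y) (t - s)‖ₑ ≤ ENNReal.ofReal (c₂ * h (t - s)) *
                (k (x - y) + 1) := by
              rw [Real.enorm_of_nonneg hY0]
              refine (ENNReal.ofReal_le_ofReal hYb).trans ?_
              rw [ENNReal.ofReal_mul (by positivity), ENNReal.ofReal_add
                (by split_ifs <;> positivity) zero_le_one, hk]
              dsimp only
              split_ifs <;> simp
            have hfe : ‖f y s‖ₑ = ENNReal.ofReal (B s) * F s y := by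
              rw [hF]
              dsimp only
              rw [mul_comm, mul_assoc, ENNReal.inv_mul_cancel (by simpa using hBs) (by simp),
                mul_one]
            calc _ ≤ ENNReal.ofReal (c₂ * h (t - s)) * (k (x - y) + 1) *
                  (ENNReal.ofReal (B s) * F s y) := by
                  rw [hfe]; gcongr
              _ = _ := by rw [hwe]; ring
        _ = w s * ((∫⁻ y, k (x - y) * F s y) + ∫⁻ y, F s y) := by
            have hm3 : Measurable (fun y => k (x - y) * F s y) :=
              (hkm.comp (by fun_prop)).mul (hFs s)
            have hm4 : Measurable (fun y => k (x - y) * F s y + F s y) := hm3.add (hFs s)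
            rw [lintegral_const_mul _ hm4, lintegral_add_left hm3]
        _ ≤ w s * A x s := by
            rw [hA]
            dsimp only
            gcongr
            exact hF1 s hs0
    have hfinal : ∫⁻ s in Ioo 0 t, w s ≤ ENNReal.ofReal (c₂ * C₀) * ENNReal.ofReal (W * t ^ (-m)) := by
      have h1 := hW t ht
      rw [hw, lintegral_const_mul _ (by fun_prop), hh]
      gcongr
    calc eLpNorm (fun x => u x t) p (volume.restrict K)
        ≤ eLpNorm (fun x => ∫⁻ s in Ioo 0 t, w s * A x s) p (volume.restrict K) := by
          refine eLpNorm_mono_enorm fun x => ?_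
          rw [enorm_eq_self]
          exact hbound x
      _ ≤ (∫⁻ s in Ioo 0 t, w s) * (M + M2) :=
          aux_minkowski_s8 _ _ p hp1 w hwm A hAm _ hAM
      _ ≤ ENNReal.ofReal (c₂ * C₀) * ENNReal.ofReal (W * t ^ (-m)) *
          ENNReal.ofReal ((M + M2).toReal) := by
          rw [ENNReal.ofReal_toReal (ENNReal.add_ne_top.2 ⟨hMt, hM2t⟩)]
          gcongr
      _ ≤ _ := by
          have ht0 : 0 < t := by linarith
          rw [← ENNReal.ofReal_mul (by positivity), ← ENNReal.ofReal_mul (by positivity)]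
          apply ENNReal.ofReal_le_ofReal
          have : 0 < c₂ * C₀ * (W * t ^ (-m)) := by positivity
          nlinarith
  refine ⟨c₂ * C₀ * W * ((M + M2).toReal + 1), by positivity, fun t ht => ⟨fun hg => ?_, fun hg => ?_⟩⟩
  · have := main t ht
    rwa [hm, min_eq_left hg] at this
  · have := main t ht
    rwa [hm, min_eq_right hg] at this
end

section
/- Let γ ∈ ℝ, let K ⊂ ℝ^N be a compact set of positive Lebesgue measure, and let f(x,t) := (1+t)^{−γ} χ_{K+B₁}(x), where K+B₁ is the set of points at distance less than 1 from K. Then there exist c > 0 and t₀ ≥ 2 such that the mild solution u satisfies u(x,t) ≥ c t^{−γ} for all x ∈ K and t ≥ t₀, and moreover, if γ > 1, also u(x,t) ≥ c t^{−(1+α)} for all x ∈ K and t ≥ t₀. Consequently, for every p ∈ [1,∞], ‖u(·,t)‖_{L^p(K)} ≥ c' t^{−γ} for γ ≤ 1+α and ‖u(·,t)‖_{L^p(K)} ≥ c' t^{−(1+α)} for γ ≥ 1+α, for t large. -/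
open MeasureTheory Real Set Filter
open scoped ENNReal Pointwise

lemma aux_G_integrable
    (N : ℕ) (β : ℝ) (hβ : 0 < β) (hN : 4 * β < (N : ℝ))
    (G : EuclideanSpace ℝ (Fin N) → ℝ)
    (hGmeas : Measurable G) (hGnonneg : ∀ ξ, 0 ≤ G ξ)
    (c₂ : ℝ)
    (hGin : ∀ ξ : EuclideanSpace ℝ (Fin N), 0 < ‖ξ‖ → ‖ξ‖ ≤ 1 →
      G ξ ≤ c₂ * ‖ξ‖ ^ (4 * β - (N : ℝ)))
    (hGout : ∀ ξ : EuclideanSpace ℝ (Fin N), 1 ≤ ‖ξ‖ →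
      G ξ ≤ c₂ * ‖ξ‖ ^ (-((N : ℝ) + 2 * β))) : Integrable G := by
  have hN0 : 0 < N := by
    have : (0:ℝ) < N := by linarith
    exact_mod_cast this
  have : Nonempty (Fin N) := ⟨⟨0, hN0⟩⟩
  have : Nontrivial (EuclideanSpace ℝ (Fin N)) :=
    Module.nontrivial_of_finrank_pos (R := ℝ) (by simpa using hN0)
  set h : ℝ → ℝ := fun r => if r ≤ 1 then r ^ (4 * β - (N : ℝ)) else r ^ (-((N : ℝ) + 2 * β)) with hh
  have hpow : ∀ r : ℝ, 0 < r → ∀ e : ℝ, r ^ (N - 1) * r ^ e = r ^ ((N:ℝ) - 1 + e) := by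
    intro r hr e
    rw [Real.rpow_add hr, ← Real.rpow_natCast, Nat.cast_sub hN0, Nat.cast_one]
  have hint : Integrable (fun x : EuclideanSpace ℝ (Fin N) => h ‖x‖) := by
    rw [integrable_fun_norm_addHaar]
    rw [← Ioc_union_Ioi_eq_Ioi (zero_le_one : (0:ℝ) ≤ 1)]
    apply IntegrableOn.union
    · have h1 : IntegrableOn (fun r : ℝ => r ^ (4 * β - 1)) (Ioc 0 1) := by
        have := (intervalIntegral.intervalIntegrable_rpow' (a := 0) (b := 1) (r := 4 * β - 1)
          (by linarith))
        rwa [intervalIntegrable_iff_integrableOn_Ioc_of_le zero_le_one] at this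
      refine h1.congr_fun ?_ measurableSet_Ioc
      intro r hr
      simp only [hh, if_pos hr.2, finrank_euclideanSpace_fin, smul_eq_mul]
      rw [hpow r hr.1]; congr 1; ring
    · have h1 : IntegrableOn (fun r : ℝ => r ^ (- 2 * β - 1)) (Ioi 1) :=
        integrableOn_Ioi_rpow_of_lt (by linarith) one_pos
      refine h1.congr_fun ?_ measurableSet_Ioi
      intro r hr
      have hr' : (1:ℝ) < r := hr
      simp only [hh, if_neg (not_le.2 hr'), finrank_euclideanSpace_fin, smul_eq_mul]
      rw [hpow r (by linarith)]; congr 1; ring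
  refine (hint.const_mul c₂).mono' hGmeas.aestronglyMeasurable ?_
  have h0 : ∀ᵐ x : EuclideanSpace ℝ (Fin N), x ≠ 0 := by
    simp [ae_iff]
  filter_upwards [h0] with x hx
  rw [Real.norm_of_nonneg (hGnonneg x)]
  by_cases h1 : ‖x‖ ≤ 1
  · simpa only [hh, if_pos h1] using hGin x (norm_pos_iff.2 hx) h1
  · simpa only [hh, if_neg h1] using hGout x (not_le.1 h1).le

lemma aux_Y_lower
    (N : ℕ) (α β : ℝ) (hα : 0 < α) (hβ : 0 < β) (hN : 4 * β < (N : ℝ))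
    (G : EuclideanSpace ℝ (Fin N) → ℝ)
    (c₁ : ℝ) (hc₁ : 0 < c₁)
    (hGin : ∀ ξ : EuclideanSpace ℝ (Fin N), 0 < ‖ξ‖ → ‖ξ‖ ≤ 1 →
      c₁ * ‖ξ‖ ^ (4 * β - (N : ℝ)) ≤ G ξ)
    (z : EuclideanSpace ℝ (Fin N)) (hz : z ≠ 0) (hz1 : ‖z‖ ≤ 1) (τ : ℝ) (hτ : 1 ≤ τ) :
    c₁ * τ ^ (-(1 + α)) ≤
      τ ^ (α - 1 - α * (N : ℝ) / (2 * β)) * G ((τ ^ (-(α / (2 * β)))) • z) := by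
  have hτ0 : 0 < τ := by linarith
  have hz0 : 0 < ‖z‖ := norm_pos_iff.2 hz
  set a := α / (2 * β) with ha
  have ha0 : 0 < a := by positivity
  have hR : 0 < τ ^ (-a) := Real.rpow_pos_of_pos hτ0 _
  have hR1 : τ ^ (-a) ≤ 1 := Real.rpow_le_one_of_one_le_of_nonpos hτ (by linarith)
  have hn : ‖τ ^ (-a) • z‖ = τ ^ (-a) * ‖z‖ := by
    rw [norm_smul, Real.norm_of_nonneg hR.le]
  have hG := hGin (τ ^ (-a) • z) (by rw [hn]; positivity)
    (by rw [hn]; exact mul_le_one₀ hR1 hz0.le hz1)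
  rw [hn, Real.mul_rpow hR.le hz0.le, ← Real.rpow_mul hτ0.le] at hG
  have hz2 : 1 ≤ ‖z‖ ^ (4 * β - (N : ℝ)) :=
    Real.one_le_rpow_of_pos_of_le_one_of_nonpos hz0 hz1 (by linarith)
  have hP : 0 < τ ^ (-a * (4 * β - (N : ℝ))) := Real.rpow_pos_of_pos hτ0 _
  have hG2 : c₁ * τ ^ (-a * (4 * β - (N : ℝ))) ≤ G (τ ^ (-a) • z) := by
    refine le_trans ?_ hG
    have := mul_le_mul_of_nonneg_left hz2 (mul_pos hc₁ hP).le
    linarith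
  have hQ : 0 < τ ^ (α - 1 - α * (N : ℝ) / (2 * β)) := Real.rpow_pos_of_pos hτ0 _
  refine le_trans (le_of_eq ?_) (mul_le_mul_of_nonneg_left hG2 hQ.le)
  have : τ ^ (-(1 + α)) = τ ^ (α - 1 - α * (N : ℝ) / (2 * β)) * τ ^ (-a * (4 * β - (N : ℝ))) := by
    rw [← Real.rpow_add hτ0]
    congr 1
    rw [ha]; field_simp; ring
  rw [this]; ring

lemma aux_scaled_integrable
    (N : ℕ) (G : EuclideanSpace ℝ (Fin N) → ℝ) (hG : Integrable G)
    (x : EuclideanSpace ℝ (Fin N)) (R : ℝ) (hR : 0 < R) :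
    Integrable (fun y => G (R • (x - y))) ∧ ∫ y, G (R • (x - y)) = (R ^ N)⁻¹ * ∫ y, G y := by
  constructor
  · exact (hG.comp_smul hR.ne').comp_sub_left x
  · rw [integral_sub_left_eq_self (fun y => G (R • y)) volume x,
      Measure.integral_comp_smul_of_nonneg _ _ _ (hR := hR.le)]
    simp

lemma aux_bochner_lower {X : Type*} [MeasurableSpace X] (μ : Measure X) (F : X → ℝ)
    (hF : Integrable F μ) (h0 : ∀ᵐ x ∂μ, 0 ≤ F x) (S : Set X) (hS : MeasurableSet S)
    (hSf : μ S ≠ ⊤) (m : ℝ) (hm : ∀ᵐ x ∂μ, x ∈ S → m ≤ F x) :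
    m * μ.real S ≤ ∫ x, F x ∂μ := by
  refine le_trans ?_ (setIntegral_le_integral (s := S) hF h0)
  have : ∫ x in S, m ∂μ = m * μ.real S := by
    rw [setIntegral_const, smul_eq_mul, mul_comm]
  rw [← this]
  refine setIntegral_mono_on_ae ?_ hF.integrableOn hS hm
  exact integrableOn_const hSf

theorem compact_sets_lower_bound
    (N : ℕ) (α β : ℝ)
    (hα : 0 < α ∧ α < 1) (hβ : 0 < β ∧ β ≤ 1) (hN : 4 * β < (N : ℝ))
    (G : EuclideanSpace ℝ (Fin N) → ℝ)
    (hGmeas : Measurable G) (hGnonneg : ∀ ξ, 0 ≤ G ξ)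
    (c₁ c₂ : ℝ) (hc₁ : 0 < c₁) (hc₂ : 0 < c₂)
    (hGin : ∀ ξ : EuclideanSpace ℝ (Fin N), 0 < ‖ξ‖ → ‖ξ‖ ≤ 1 →
      c₁ * ‖ξ‖ ^ (4 * β - (N : ℝ)) ≤ G ξ ∧ G ξ ≤ c₂ * ‖ξ‖ ^ (4 * β - (N : ℝ)))
    (hGout : ∀ ξ : EuclideanSpace ℝ (Fin N), 1 ≤ ‖ξ‖ →
      c₁ * ‖ξ‖ ^ (-((N : ℝ) + 2 * β)) ≤ G ξ ∧ G ξ ≤ c₂ * ‖ξ‖ ^ (-((N : ℝ) + 2 * β)))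
    (Y : EuclideanSpace ℝ (Fin N) → ℝ → ℝ)
    (hY : ∀ x t, Y x t = t ^ (α - 1 - α * (N : ℝ) / (2 * β)) * G ((t ^ (-(α / (2 * β)))) • x))
    (γ : ℝ) (K : Set (EuclideanSpace ℝ (Fin N))) (hK : IsCompact K) (hKpos : 0 < volume K)
    (f : EuclideanSpace ℝ (Fin N) → ℝ → ℝ)
    (hf : ∀ x t, f x t =
      (1 + t) ^ (-γ) *
        Set.indicator (K + Metric.ball (0 : EuclideanSpace ℝ (Fin N)) 1) (fun _ => (1:ℝ)) x)
    (u : EuclideanSpace ℝ (Fin N) → ℝ → ℝ)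
    (hu : ∀ x t, u x t = ∫ s in Set.Ioc (0:ℝ) t, ∫ y, Y (x - y) (t - s) * f y s) :
    ∃ c : ℝ, 0 < c ∧ ∃ t₀ : ℝ, 2 ≤ t₀ ∧
      (∀ x ∈ K, ∀ t : ℝ, t₀ ≤ t → c * t ^ (-γ) ≤ u x t) ∧
      (1 < γ → ∀ x ∈ K, ∀ t : ℝ, t₀ ≤ t → c * t ^ (-(1 + α)) ≤ u x t) ∧
      (∀ p : ℝ≥0∞, 1 ≤ p → ∃ c' : ℝ, 0 < c' ∧ ∃ t₁ : ℝ, 2 ≤ t₁ ∧ ∀ t : ℝ, t₁ ≤ t →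
        (γ ≤ 1 + α →
          ENNReal.ofReal (c' * t ^ (-γ)) ≤ eLpNorm (fun x => u x t) p (volume.restrict K)) ∧
        (1 + α ≤ γ →
          ENNReal.ofReal (c' * t ^ (-(1 + α))) ≤
            eLpNorm (fun x => u x t) p (volume.restrict K))) := by
  obtain ⟨hα0, hα1⟩ := hα
  obtain ⟨hβ0, hβ1⟩ := hβ
  have hGint : Integrable G := aux_G_integrable N β hβ0 hN G hGmeas hGnonneg c₂
    (fun ξ h1 h2 => (hGin ξ h1 h2).2) (fun ξ h1 => (hGout ξ h1).2)
  have hN0 : 0 < N := by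
    have : (0:ℝ) < N := by linarith
    exact_mod_cast this
  have hnt : Nontrivial (EuclideanSpace ℝ (Fin N)) :=
    Module.nontrivial_of_finrank_pos (R := ℝ) (by simpa using hN0)
  set A : Set (EuclideanSpace ℝ (Fin N)) := K + Metric.ball 0 1 with hA
  have hAm : MeasurableSet A := (Metric.isOpen_ball.add_left).measurableSet
  have hYnn : ∀ x t, 0 ≤ t → 0 ≤ Y x t := by
    intro x t ht
    rw [hY]
    exact mul_nonneg (Real.rpow_nonneg ht _) (hGnonneg _)
  have hfnn : ∀ x t, 0 ≤ t → 0 ≤ f x t := by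
    intro x t ht
    rw [hf]
    exact mul_nonneg (Real.rpow_nonneg (by linarith) _) (indicator_nonneg (fun _ _ => zero_le_one) _)
  set E := α - 1 - α * (N : ℝ) / (2 * β) with hE
  set a := α / (2 * β) with ha
  have hYint : ∀ x τ, 0 < τ → Integrable (fun y => Y (x - y) τ) ∧
      ∫ y, Y (x - y) τ = τ ^ (α - 1) * ∫ y, G y := by
    intro x τ hτ
    have hR : 0 < τ ^ (-a) := Real.rpow_pos_of_pos hτ _
    obtain ⟨h1, h2⟩ := aux_scaled_integrable N G hGint x _ hR
    simp only [hY]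
    refine ⟨h1.const_mul _, ?_⟩
    rw [integral_const_mul, h2, ← mul_assoc]
    congr 1
    rw [← Real.rpow_natCast, ← Real.rpow_mul hτ.le, ← Real.rpow_neg hτ.le, ← Real.rpow_add hτ]
    congr 1
    rw [hE, ha]; field_simp; ring
  have hFeq : ∀ x t s, (fun y => Y (x - y) (t - s) * f y s) =
      fun y => (1 + s) ^ (-γ) * A.indicator (fun y => Y (x - y) (t - s)) y := by
    intro x t s
    funext y
    rw [hf]
    by_cases hy : y ∈ A
    · simp [hy, mul_comm]
    · simp [hy]
  have hFint : ∀ x t s, s < t → Integrable (fun y => Y (x - y) (t - s) * f y s) := by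
    intro x t s hst
    rw [hFeq]
    exact ((hYint x (t - s) (by linarith)).1.indicator hAm).const_mul _
  have hFnn : ∀ x t s, 0 ≤ s → s ≤ t → ∀ y, 0 ≤ Y (x - y) (t - s) * f y s := by
    intro x t s h0 h1 y
    exact mul_nonneg (hYnn _ _ (by linarith)) (hfnn _ _ h0)
  have hFup : ∀ x t s, 0 < s → s < t → ∫ y, Y (x - y) (t - s) * f y s ≤
      (1 + s) ^ (-γ) * ((t - s) ^ (α - 1) * ∫ y, G y) := by
    intro x t s h0 h1
    rw [hFeq, integral_const_mul, integral_indicator hAm]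
    obtain ⟨h2, h3⟩ := hYint x (t - s) (by linarith)
    refine mul_le_mul_of_nonneg_left ?_ (Real.rpow_nonneg (by linarith) _)
    rw [← h3]
    exact setIntegral_le_integral h2 (Eventually.of_forall fun y => hYnn _ _ (by linarith))
  have hinner_int : ∀ x t, 0 < t →
      IntegrableOn (fun s => ∫ y, Y (x - y) (t - s) * f y s) (Ioc 0 t) := by
    intro x t ht
    have hmeas : StronglyMeasurable (fun s : ℝ => ∫ y, Y (x - y) (t - s) * f y s) := by
      have hm : Measurable (fun q : ℝ × EuclideanSpace ℝ (Fin N) =>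
          Y (x - q.2) (t - q.1) * f q.2 q.1) := by
        simp only [hY, hf]
        have hi : Measurable (A.indicator (fun _ => (1:ℝ))) := measurable_const.indicator hAm
        have h1 : Measurable (fun q : ℝ × EuclideanSpace ℝ (Fin N) =>
            A.indicator (fun _ => (1:ℝ)) q.2) := hi.comp measurable_snd
        have h2 : Measurable (fun q : ℝ × EuclideanSpace ℝ (Fin N) =>
            G ((t - q.1) ^ (-a) • (x - q.2))) := hGmeas.comp (by fun_prop)
        exact Measurable.mul (Measurable.mul (by fun_prop) h2) (Measurable.mul (by fun_prop) h1)
      exact hm.stronglyMeasurable.integral_prod_right'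
    have hb : IntegrableOn (fun s : ℝ => (1 + s) ^ (-γ) * ((t - s) ^ (α - 1) * ∫ y, G y))
        (Ioc 0 t) := by
      have h1 : IntervalIntegrable (fun s : ℝ => (t - s) ^ (α - 1)) volume 0 t := by
        have h := (intervalIntegral.intervalIntegrable_rpow' (a := t) (b := 0) (r := α - 1)
          (by linarith)).comp_sub_left t
        simpa using h
      have h2 := (h1.mul_const (∫ y, G y)).continuousOn_mul (g := fun s : ℝ => (1 + s) ^ (-γ)) (by
        intro s hs
        rw [uIcc_of_le ht.le] at hs
        apply ContinuousAt.continuousWithinAt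
        refine ContinuousAt.rpow_const (by fun_prop) (Or.inl ?_)
        have := hs.1
        positivity)
      rwa [intervalIntegrable_iff_integrableOn_Ioc_of_le ht.le] at h2
    refine hb.mono' hmeas.aestronglyMeasurable ?_
    have hne : ∀ᵐ s : ℝ ∂(volume.restrict (Ioc 0 t)), s ≠ t :=
      ae_restrict_of_ae (by simp [ae_iff])
    filter_upwards [hne, ae_restrict_mem measurableSet_Ioc] with s hs1 hs2
    have hlt : s < t := lt_of_le_of_ne hs2.2 hs1
    rw [Real.norm_of_nonneg (integral_nonneg (hFnn x t s hs2.1.le hs2.2))]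
    exact hFup x t s hs2.1 hlt
  set b := volume.real (Metric.ball (0 : EuclideanSpace ℝ (Fin N)) 1) with hb
  have hb0 : 0 < b := by
    rw [hb]
    exact ENNReal.toReal_pos (Metric.measure_ball_pos volume _ one_pos).ne' measure_ball_lt_top.ne
  have hlow : ∀ x ∈ K, ∀ t s, 0 < s → s ≤ t - 1 →
      (c₁ * b) * ((t - s) ^ (-(1 + α)) * (1 + s) ^ (-γ)) ≤ ∫ y, Y (x - y) (t - s) * f y s := by
    intro x hx t s h0 h1
    have hball : volume.real (Metric.ball x 1) = b := by
      rw [hb, Measure.real, Measure.real, Measure.addHaar_ball_center]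
    have key := aux_bochner_lower volume _ (hFint x t s (by linarith))
      (Eventually.of_forall (hFnn x t s h0.le (by linarith))) (Metric.ball x 1)
      Metric.isOpen_ball.measurableSet measure_ball_lt_top.ne
      ((c₁ * (t - s) ^ (-(1 + α))) * (1 + s) ^ (-γ)) (by
        have hne : ∀ᵐ y : EuclideanSpace ℝ (Fin N), y ≠ x := by simp [ae_iff]
        filter_upwards [hne] with y hy hyb
        have hyA : y ∈ A := by
          refine Set.mem_add.2 ⟨x, hx, y - x, ?_, by abel⟩
          rw [mem_ball_zero_iff, ← dist_eq_norm]
          exact hyb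
        rw [hf, indicator_of_mem hyA, mul_one]
        refine mul_le_mul_of_nonneg_right ?_ (Real.rpow_nonneg (by linarith) _)
        rw [hY]
        refine aux_Y_lower N α β hα0 hβ0 hN G c₁ hc₁ (fun ξ h1 h2 => (hGin ξ h1 h2).1) (x - y)
          (sub_ne_zero.2 hy.symm) ?_ (t - s) (by linarith)
        rw [← dist_eq_norm, dist_comm]
        exact (Metric.mem_ball.1 hyb).le)
    rw [hball] at key
    linarith
  have hulow : ∀ x ∈ K, ∀ t l m, 0 < t → 0 ≤ l → l + 1 ≤ t →
      (∀ s, s ∈ Ioc l (l + 1) → m ≤ ∫ y, Y (x - y) (t - s) * f y s) → m ≤ u x t := by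
    intro x hx t l m ht hl hlt hm
    rw [hu]
    have key := aux_bochner_lower (volume.restrict (Ioc 0 t)) _ (hinner_int x t ht)
      (by
        filter_upwards [ae_restrict_mem measurableSet_Ioc] with s hs
        exact integral_nonneg (hFnn x t s hs.1.le hs.2)) (Ioc l (l + 1)) measurableSet_Ioc
      (measure_ne_top _ _) m (Eventually.of_forall hm)
    have hv : (volume.restrict (Ioc 0 t)).real (Ioc l (l + 1)) = 1 := by
      rw [Measure.real, Measure.restrict_apply measurableSet_Ioc,
        inter_eq_left.2 (Ioc_subset_Ioc hl hlt)]
      simp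
    rw [hv, mul_one] at key
    exact key
  have hκ : 0 < c₁ * b := mul_pos hc₁ hb0
  set d₁ : ℝ := (c₁ * b) * (2 ^ (-(1 + α)) * (1 / 2) ^ |γ|) with hd₁
  set d₂ : ℝ := (c₁ * b) * 2 ^ (-γ) with hd₂
  have hd₁0 : 0 < d₁ := by positivity
  have hd₂0 : 0 < d₂ := by positivity
  have P1 : ∀ x ∈ K, ∀ t : ℝ, 4 ≤ t → min d₁ d₂ * t ^ (-γ) ≤ u x t := by
    intro x hx t ht
    have ht0 : 0 < t := by linarith
    refine hulow x hx t (t - 2) _ ht0 (by linarith) (by linarith) ?_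
    intro s hs
    have hs1 : t - 2 < s := hs.1
    have hs2 : s ≤ t - 1 := by linarith [hs.2]
    refine le_trans ?_ (hlow x hx t s (by linarith) hs2)
    refine le_trans (mul_le_mul_of_nonneg_right (min_le_left _ _) (Real.rpow_nonneg ht0.le _)) ?_
    rw [hd₁, mul_assoc (c₁ * b), mul_assoc (2 ^ (-(1 + α)))]
    refine mul_le_mul_of_nonneg_left ?_ hκ.le
    refine mul_le_mul ?_ ?_ (by positivity) (Real.rpow_nonneg (by linarith) _)
    · exact Real.rpow_le_rpow_of_nonpos (by linarith) (by linarith) (by linarith)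
    · have hr1 : 1 / 2 ≤ (1 + s) / t := by
        rw [div_le_div_iff₀ two_pos ht0]; linarith
      have hr2 : (1 + s) / t ≤ 1 := by
        rw [div_le_one ht0]; linarith
      have h1 : (1 / 2 : ℝ) ^ |γ| ≤ ((1 + s) / t) ^ |γ| :=
        Real.rpow_le_rpow (by norm_num) hr1 (abs_nonneg _)
      have h2 : ((1 + s) / t) ^ |γ| ≤ ((1 + s) / t) ^ (-γ) :=
        Real.rpow_le_rpow_of_exponent_ge (by linarith) hr2 (neg_le_abs γ)
      have h3 : ((1 + s) / t) ^ (-γ) * t ^ (-γ) = (1 + s) ^ (-γ) := by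
        rw [← Real.mul_rpow (by linarith) ht0.le, div_mul_cancel₀ _ ht0.ne']
      rw [← h3]
      exact mul_le_mul_of_nonneg_right (h1.trans h2) (Real.rpow_nonneg ht0.le _)
  have P2 : 1 < γ → ∀ x ∈ K, ∀ t : ℝ, 4 ≤ t → min d₁ d₂ * t ^ (-(1 + α)) ≤ u x t := by
    intro hγ x hx t ht
    have ht0 : 0 < t := by linarith
    refine hulow x hx t 0 _ ht0 le_rfl (by linarith) ?_
    intro s hs
    have hs1 : 0 < s := hs.1
    have hs2 : s ≤ 1 := by linarith [hs.2]
    refine le_trans ?_ (hlow x hx t s hs1 (by linarith))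
    refine le_trans (mul_le_mul_of_nonneg_right (min_le_right _ _) (Real.rpow_nonneg ht0.le _)) ?_
    rw [hd₂, mul_assoc (c₁ * b)]
    refine mul_le_mul_of_nonneg_left ?_ hκ.le
    rw [mul_comm]
    refine mul_le_mul ?_ ?_ (by positivity) (Real.rpow_nonneg (by linarith) _)
    · exact Real.rpow_le_rpow_of_nonpos (by linarith) (by linarith) (by linarith)
    · exact Real.rpow_le_rpow_of_nonpos (by linarith) (by linarith) (by linarith)
  have hc : 0 < min d₁ d₂ := lt_min hd₁0 hd₂0
  refine ⟨min d₁ d₂, hc, 4, by norm_num, P1, P2, ?_⟩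
  intro p hp
  have hKfin : volume K ≠ ⊤ := hK.measure_lt_top.ne
  have hKr : 0 < (volume K).toReal := ENNReal.toReal_pos hKpos.ne' hKfin
  set v : ℝ := (volume K).toReal ^ (1 / p.toReal) with hv
  have hv0 : 0 < v := Real.rpow_pos_of_pos hKr _
  have hLp : ∀ t m : ℝ, 0 ≤ m → (∀ x ∈ K, m ≤ u x t) →
      ENNReal.ofReal (m * v) ≤ eLpNorm (fun x => u x t) p (volume.restrict K) := by
    intro t m hm h
    have h1 : eLpNorm (fun _ : EuclideanSpace ℝ (Fin N) => m) p (volume.restrict K) ≤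
        eLpNorm (fun x => u x t) p (volume.restrict K) := by
      refine eLpNorm_mono_ae ?_
      filter_upwards [ae_restrict_mem hK.measurableSet] with x hx
      rw [Real.norm_of_nonneg hm, Real.norm_of_nonneg (hm.trans (h x hx))]
      exact h x hx
    refine le_trans (le_of_eq ?_) h1
    rw [eLpNorm_const _ (by positivity) (by
      rw [Ne, Measure.restrict_eq_zero]; exact hKpos.ne'), Measure.restrict_apply_univ,
      Real.enorm_of_nonneg hm, ENNReal.ofReal_mul hm, hv,
      ← ENNReal.ofReal_rpow_of_pos hKr, ENNReal.ofReal_toReal hKfin]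
  refine ⟨min d₁ d₂ * v, mul_pos hc hv0, 4, by norm_num, ?_⟩
  intro t ht
  have ht0 : 0 < t := by linarith
  constructor
  · intro _
    have := hLp t _ (by positivity) (fun x hx => P1 x hx t ht)
    rwa [mul_right_comm] at this
  · intro hγ
    have := hLp t _ (by positivity) (fun x hx => P2 (by linarith) x hx t ht)
    rwa [mul_right_comm] at this
end

section
/- Let p ∈ [1, p_c), γ ∈ ℝ, 0 < ν < μ < ∞, and let g : (0,∞) → (0,∞) satisfy g(t) → ∞ and g(t)/t^{α/(2β)} → 0 as t → ∞. Suppose ‖f(·,t)‖_{L^1(ℝ^N)} ≤ C₀ (1+t)^{−γ} for all t ≥ 0. Then there are C > 0 and t₀ ≥ 2 such that the mild solution u satisfies, for all t ≥ t₀: ‖u(·,t)‖_{L^p({ν ≤ |x|/g(t) ≤ μ})} ≤ C g(t)^{2β−N(1−1/p)} t^{−γ} if γ < 1; ≤ C g(t)^{2β−N(1−1/p)} max{t^{−1}, t^{−(1+α)} g(t)^{2β} log t} if γ = 1; and ≤ C g(t)^{2β−N(1−1/p)} max{t^{−γ}, t^{−(1+α)} g(t)^{2β}} if γ > 1. -/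
open MeasureTheory Real Set Filter
open scoped ENNReal Pointwise

lemma jensen_pow {Z : Type*} [MeasurableSpace Z] (M : Measure Z) (k : Z → ℝ≥0∞)
    (hk : Measurable k) (p : ℝ) (hp : 1 ≤ p) :
    (∫⁻ z, k z ∂M) ^ p ≤ M univ ^ (p - 1) * ∫⁻ z, k z ^ p ∂M := by
  have h := eLpNorm'_le_eLpNorm'_mul_rpow_measure_univ (f := k) (μ := M) one_pos hp
    hk.aestronglyMeasurable
  have hp0 : (0:ℝ) < p := by linarith
  have h2 := ENNReal.rpow_le_rpow h hp0.le
  rw [ENNReal.mul_rpow_of_nonneg _ _ hp0.le] at h2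
  simp only [eLpNorm'_eq_lintegral_enorm, enorm_eq_self, ENNReal.rpow_one, one_div_one] at h2
  rw [← ENNReal.rpow_mul, ← ENNReal.rpow_mul, one_div_mul_cancel hp0.ne', ENNReal.rpow_one] at h2
  rw [mul_comm]
  convert h2 using 3
  field_simp

lemma jensen_mink {X Z : Type*} [MeasurableSpace X] [MeasurableSpace Z] (ρ : Measure X)
    (m : Measure Z) [SFinite ρ] [SFinite m] (K : X → Z → ℝ≥0∞)
    (hK : Measurable (Function.uncurry K)) (w : Z → ℝ≥0∞) (hw : Measurable w)
    (hw0 : ∀ z, w z ≠ 0) (hwt : ∀ z, w z ≠ ∞) (p : ℝ) (hp : 1 ≤ p)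
    (h : ∀ᵐ z ∂m, ∫⁻ x, K x z ^ p ∂ρ ≤ w z ^ p) :
    ∫⁻ x, (∫⁻ z, K x z ∂m) ^ p ∂ρ ≤ (∫⁻ z, w z ∂m) ^ p := by
  have hp0 : (0:ℝ) < p := by linarith
  have hKx : ∀ x, Measurable (K x) := fun x => hK.comp measurable_prodMk_left
  have hKz : ∀ z, Measurable (fun x => K x z) := fun z => hK.comp measurable_prodMk_right
  set W := ∫⁻ z, w z ∂m with hW
  have key : ∀ x, (∫⁻ z, K x z ∂m) ^ p ≤ W ^ (p - 1) * ∫⁻ z, w z * (K x z / w z) ^ p ∂m := by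
    intro x
    have hq : Measurable (fun z => K x z / w z) := (hKx x).div hw
    have h1 := jensen_pow (m.withDensity w) (fun z => K x z / w z) hq p hp
    rw [lintegral_withDensity_eq_lintegral_mul _ hw hq,
      lintegral_withDensity_eq_lintegral_mul _ hw (hq.pow_const p),
      withDensity_apply _ MeasurableSet.univ, Measure.restrict_univ] at h1
    have e : ∀ z, K x z = (w * fun z => K x z / w z) z := by
      intro z
      simp only [Pi.mul_apply]
      rw [ENNReal.mul_div_cancel (hw0 z) (hwt z)]
    calc (∫⁻ z, K x z ∂m) ^ p = (∫⁻ z, (w * fun z => K x z / w z) z ∂m) ^ p := by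
          rw [lintegral_congr e]
      _ ≤ _ := h1
  have hmeas : Measurable (Function.uncurry fun x z => w z * (K x z / w z) ^ p) := by
    have h1 : Measurable fun q : X × Z => w q.2 := hw.comp measurable_snd
    exact h1.mul ((hK.div h1).pow_const p)
  calc ∫⁻ x, (∫⁻ z, K x z ∂m) ^ p ∂ρ
      ≤ ∫⁻ x, W ^ (p - 1) * ∫⁻ z, w z * (K x z / w z) ^ p ∂m ∂ρ := lintegral_mono key
    _ = W ^ (p - 1) * ∫⁻ x, ∫⁻ z, w z * (K x z / w z) ^ p ∂m ∂ρ := by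
        rw [lintegral_const_mul]
        exact hmeas.lintegral_prod_right'
    _ = W ^ (p - 1) * ∫⁻ z, ∫⁻ x, w z * (K x z / w z) ^ p ∂ρ ∂m := by
        rw [lintegral_lintegral_swap hmeas.aemeasurable]
    _ ≤ W ^ (p - 1) * W := by
        gcongr
        rw [hW]
        apply lintegral_mono_ae
        filter_upwards [h] with z hz
        rw [lintegral_const_mul _ (((hKz z).div_const _).pow_const p)]
        have : ∫⁻ x, (K x z / w z) ^ p ∂ρ ≤ 1 := by
          simp_rw [ENNReal.div_rpow_of_nonneg _ _ hp0.le, div_eq_mul_inv]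
          rw [lintegral_mul_const _ ((hKz z).pow_const p), ← div_eq_mul_inv]
          exact ENNReal.div_le_of_le_mul (by simpa using hz)
        calc w z * _ ≤ w z * 1 := by gcongr
          _ = w z := mul_one _
    _ = W ^ p := by
        nth_rw 2 [← ENNReal.rpow_one W]
        rw [← ENNReal.rpow_add_of_nonneg _ _ (by linarith) zero_le_one]
        congr 1; ring


noncomputable def prof (N : ℕ) (β r : ℝ) : ℝ :=
  if r ≤ 1 then r ^ (4 * β - (N : ℝ)) else r ^ (-((N : ℝ) + 2 * β))

lemma prof_meas (N : ℕ) (β : ℝ) : Measurable (prof N β) := by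
  unfold prof
  exact Measurable.ite measurableSet_Iic (by fun_prop) (by fun_prop)

lemma prof_nonneg (N : ℕ) (β r : ℝ) (hr : 0 ≤ r) : 0 ≤ prof N β r := by
  unfold prof; split_ifs <;> positivity

lemma prof_fin (N : ℕ) (β p : ℝ) (hβ : 0 < β) (hN : 4 * β < N) (hp : 1 ≤ p)
    (hpp : p * (N - 4 * β) < N) :
    ∃ I : ℝ, 0 ≤ I ∧ ∫⁻ ξ : EuclideanSpace ℝ (Fin N), ENNReal.ofReal (prof N β ‖ξ‖) ^ p
      = ENNReal.ofReal I := by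
  have hN0 : 0 < N := by
    have : (0:ℝ) < N := by linarith
    exact_mod_cast this
  have : NeZero N := ⟨hN0.ne'⟩
  have hint : Integrable (fun ξ : EuclideanSpace ℝ (Fin N) => (fun r => prof N β r ^ p) ‖ξ‖) := by
    refine (integrable_fun_norm_addHaar (μ := (volume : Measure (EuclideanSpace ℝ (Fin N))))
      (f := fun r => prof N β r ^ p)).2 ?_
    rw [finrank_euclideanSpace_fin]
    have hcast : ((N - 1 : ℕ) : ℝ) = N - 1 := by
      rw [Nat.cast_sub (by omega)]; simp
    rw [← Ioc_union_Ioi_eq_Ioi zero_le_one]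
    apply IntegrableOn.union
    · have h1 : IntegrableOn (fun y : ℝ => y ^ (((N:ℝ) - 1) + (4 * β - N) * p)) (Ioc 0 1) := by
        rw [integrableOn_Ioc_iff_integrableOn_Ioo, intervalIntegral.integrableOn_Ioo_rpow_iff one_pos]
        nlinarith
      refine h1.congr_fun (fun y hy => ?_) measurableSet_Ioc
      have hy0 : 0 < y := hy.1
      simp only [prof, if_pos hy.2, smul_eq_mul]
      rw [rpow_add hy0, ← hcast, rpow_natCast, ← rpow_mul hy0.le]
    · have h1 : IntegrableOn (fun y : ℝ => y ^ (((N:ℝ) - 1) + (-((N : ℝ) + 2 * β)) * p)) (Ioi 1) := by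
        apply integrableOn_Ioi_rpow_of_lt _ one_pos
        nlinarith
      refine h1.congr_fun (fun y hy => ?_) measurableSet_Ioi
      have hy1 : 1 < y := hy
      have hy0 : 0 < y := by linarith
      simp only [prof, if_neg (not_le.2 hy1), smul_eq_mul]
      rw [rpow_add hy0, ← hcast, rpow_natCast, ← rpow_mul hy0.le]
  refine ⟨∫ ξ : EuclideanSpace ℝ (Fin N), prof N β ‖ξ‖ ^ p, ?_, ?_⟩
  · exact integral_nonneg fun ξ => rpow_nonneg (prof_nonneg _ _ _ (norm_nonneg _)) _
  · rw [ofReal_integral_eq_lintegral_ofReal hint]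
    · congr 1; ext ξ
      rw [ENNReal.ofReal_rpow_of_nonneg (prof_nonneg _ _ _ (norm_nonneg _)) (by linarith)]
    · exact Eventually.of_forall fun ξ => rpow_nonneg (prof_nonneg _ _ _ (norm_nonneg _)) _

lemma prof_scale (N : ℕ) (β p I r : ℝ) (hr : 0 < r)
    (hI : ∫⁻ ξ : EuclideanSpace ℝ (Fin N), ENNReal.ofReal (prof N β ‖ξ‖) ^ p
      = ENNReal.ofReal I) (y : EuclideanSpace ℝ (Fin N)) :
    ∫⁻ x : EuclideanSpace ℝ (Fin N), ENNReal.ofReal (prof N β ‖r • (x - y)‖) ^ p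
      = ENNReal.ofReal (r ^ (-(N:ℝ)) * I) := by
  have hm : Measurable fun ξ : EuclideanSpace ℝ (Fin N) => ENNReal.ofReal (prof N β ‖ξ‖) ^ p :=
    (((prof_meas N β).comp measurable_norm).ennreal_ofReal).pow_const p
  rw [lintegral_sub_right_eq_self
    (fun x : EuclideanSpace ℝ (Fin N) => ENNReal.ofReal (prof N β ‖r • x‖) ^ p) y]
  have h := lintegral_map (μ := (volume : Measure (EuclideanSpace ℝ (Fin N)))) hm
    (measurable_const_smul r)
  rw [← h, Measure.map_addHaar_smul _ hr.ne', lintegral_smul_measure, hI,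
    finrank_euclideanSpace_fin, ENNReal.ofReal_mul (by positivity), smul_eq_mul,
    abs_of_pos (by positivity), rpow_neg hr.le, rpow_natCast]

lemma kernel_bound (N : ℕ) (α β : ℝ)
    (hα : 0 < α ∧ α < 1) (hβ : 0 < β ∧ β ≤ 1)
    (G : EuclideanSpace ℝ (Fin N) → ℝ) (hGnonneg : ∀ ξ, 0 ≤ G ξ)
    (c₂ : ℝ) 
    (hGin : ∀ ξ : EuclideanSpace ℝ (Fin N), 0 < ‖ξ‖ → ‖ξ‖ ≤ 1 →
       G ξ ≤ c₂ * ‖ξ‖ ^ (4 * β - (N : ℝ)))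
    (hGout : ∀ ξ : EuclideanSpace ℝ (Fin N), 1 ≤ ‖ξ‖ →
      G ξ ≤ c₂ * ‖ξ‖ ^ (-((N : ℝ) + 2 * β)))
    (Y : EuclideanSpace ℝ (Fin N) → ℝ → ℝ)
    (hY : ∀ x t, Y x t = t ^ (α - 1 - α * (N : ℝ) / (2 * β)) * G ((t ^ (-(α / (2 * β)))) • x))
    (x : EuclideanSpace ℝ (Fin N)) (hx : x ≠ 0) (τ : ℝ) (hτ : 0 < τ) :
    ‖Y x τ‖ₑ ≤ ENNReal.ofReal (τ ^ (α - 1 - α * (N : ℝ) / (2 * β)) * c₂) *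
        ENNReal.ofReal (prof N β ‖(τ ^ (-(α / (2 * β)))) • x‖) := by
  have hr : 0 < τ ^ (-(α / (2 * β))) := by positivity
  have hpos : 0 < ‖(τ ^ (-(α / (2 * β)))) • x‖ := by
    rw [norm_pos_iff]; exact smul_ne_zero hr.ne' hx
  rw [hY, Real.enorm_eq_ofReal (mul_nonneg (by positivity) (hGnonneg _)),
    ← ENNReal.ofReal_mul' (prof_nonneg _ _ _ (norm_nonneg _))]
  apply ENNReal.ofReal_le_ofReal
  rw [mul_assoc]
  gcongr
  unfold prof
  split_ifs with h
  · exact hGin _ hpos h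
  · exact hGout _ (not_le.1 h).le

lemma kernel1 (N : ℕ) (α β : ℝ)
    (hα : 0 < α ∧ α < 1) (hβ : 0 < β ∧ β ≤ 1) (hN : 4 * β < (N : ℝ))
    (G : EuclideanSpace ℝ (Fin N) → ℝ) (hGnonneg : ∀ ξ, 0 ≤ G ξ)
    (c₂ : ℝ) (hc₂ : 0 < c₂)
    (hGin : ∀ ξ : EuclideanSpace ℝ (Fin N), 0 < ‖ξ‖ → ‖ξ‖ ≤ 1 →
       G ξ ≤ c₂ * ‖ξ‖ ^ (4 * β - (N : ℝ)))
    (hGout : ∀ ξ : EuclideanSpace ℝ (Fin N), 1 ≤ ‖ξ‖ →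
      G ξ ≤ c₂ * ‖ξ‖ ^ (-((N : ℝ) + 2 * β)))
    (Y : EuclideanSpace ℝ (Fin N) → ℝ → ℝ)
    (hY : ∀ x t, Y x t = t ^ (α - 1 - α * (N : ℝ) / (2 * β)) * G ((t ^ (-(α / (2 * β)))) • x))
    (p : ℝ) (hp : 1 ≤ p) (I : ℝ) (hI0 : 0 ≤ I)
    (hI : ∫⁻ ξ : EuclideanSpace ℝ (Fin N), ENNReal.ofReal (prof N β ‖ξ‖) ^ p
      = ENNReal.ofReal I)
    (y : EuclideanSpace ℝ (Fin N)) (τ : ℝ) (hτ : 0 < τ) :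
    ∫⁻ x, ‖Y (x - y) τ‖ₑ ^ p ≤
      ENNReal.ofReal ((c₂ * I ^ (1 / p)) * τ ^ (α - 1 - α * N / (2 * β) * (1 - 1 / p))) ^ p := by
  have hN0 : 0 < N := by
    have : (0:ℝ) < N := by linarith
    exact_mod_cast this
  have : NeZero N := ⟨hN0.ne'⟩
  have hp0 : 0 < p := by linarith
  have hr : 0 < τ ^ (-(α / (2 * β))) := by positivity
  have hae : ∀ᵐ x : EuclideanSpace ℝ (Fin N), x ≠ y := compl_mem_ae_iff.2 (measure_singleton y)
  have hm : Measurable fun x : EuclideanSpace ℝ (Fin N) =>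
      ENNReal.ofReal (prof N β ‖τ ^ (-(α / (2 * β))) • (x - y)‖) ^ p :=
    (((prof_meas N β).comp (by fun_prop)).ennreal_ofReal).pow_const p
  calc ∫⁻ x, ‖Y (x - y) τ‖ₑ ^ p
      ≤ ∫⁻ x, ENNReal.ofReal (τ ^ (α - 1 - α * (N : ℝ) / (2 * β)) * c₂) ^ p *
        ENNReal.ofReal (prof N β ‖(τ ^ (-(α / (2 * β)))) • (x - y)‖) ^ p := by
        apply lintegral_mono_ae
        filter_upwards [hae] with x hx
        rw [← ENNReal.mul_rpow_of_nonneg _ _ hp0.le]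
        exact ENNReal.rpow_le_rpow (kernel_bound N α β hα hβ G hGnonneg c₂ hGin hGout Y hY
          (x - y) (sub_ne_zero.2 hx) τ hτ) hp0.le
    _ = _ := by
        rw [lintegral_const_mul _ hm, prof_scale N β p I _ hr hI y,
          ENNReal.ofReal_rpow_of_nonneg (by positivity) hp0.le,
          ENNReal.ofReal_rpow_of_nonneg (by positivity) hp0.le,
          ← ENNReal.ofReal_mul (by positivity)]
        congr 1
        rw [mul_rpow (by positivity) hc₂.le, mul_rpow (by positivity) (by positivity),
          mul_rpow hc₂.le (by positivity), ← rpow_mul hI0, one_div_mul_cancel hp0.ne', rpow_one,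
          ← rpow_mul hτ.le, ← rpow_mul hτ.le, ← rpow_mul hτ.le]
        have : τ ^ ((α - 1 - α * ↑N / (2 * β) * (1 - 1 / p)) * p) =
          τ ^ ((α - 1 - α * ↑N / (2 * β)) * p) * τ ^ (-(α / (2 * β)) * -↑N) := by
          rw [← rpow_add hτ]; congr 1; field_simp; ring
        rw [this]; ring

lemma kernel2 (N : ℕ) (α β : ℝ)
    (hα : 0 < α ∧ α < 1) (hβ : 0 < β ∧ β ≤ 1) (hN : 4 * β < (N : ℝ))
    (G : EuclideanSpace ℝ (Fin N) → ℝ) (hGnonneg : ∀ ξ, 0 ≤ G ξ)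
    (c₂ : ℝ) (hc₂ : 0 < c₂)
    (hGin : ∀ ξ : EuclideanSpace ℝ (Fin N), 0 < ‖ξ‖ → ‖ξ‖ ≤ 1 →
       G ξ ≤ c₂ * ‖ξ‖ ^ (4 * β - (N : ℝ)))
    (hGout : ∀ ξ : EuclideanSpace ℝ (Fin N), 1 ≤ ‖ξ‖ →
      G ξ ≤ c₂ * ‖ξ‖ ^ (-((N : ℝ) + 2 * β)))
    (Y : EuclideanSpace ℝ (Fin N) → ℝ → ℝ)
    (hY : ∀ x t, Y x t = t ^ (α - 1 - α * (N : ℝ) / (2 * β)) * G ((t ^ (-(α / (2 * β)))) • x))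
    (p : ℝ) (hp : 1 ≤ p) (I : ℝ) (hI0 : 0 ≤ I)
    (hI : ∫⁻ ξ : EuclideanSpace ℝ (Fin N), ENNReal.ofReal (prof N β ‖ξ‖) ^ p
      = ENNReal.ofReal I) (μ : ℝ) (hμ : 0 < μ) :
    ∃ D : ℝ, 0 < D ∧ ∀ (y : EuclideanSpace ℝ (Fin N)) (τ : ℝ) (_ : 0 < τ) (g : ℝ) (_ : 0 < g),
    ∫⁻ x in Metric.closedBall 0 (μ * g), ‖Y (x - y) τ‖ₑ ^ p ≤
      ENNReal.ofReal (D * (τ ^ (-1 - α) * g ^ (4 * β - N * (1 - 1 / p)))) ^ p := by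
  have hN0 : 0 < N := by
    have : (0:ℝ) < N := by linarith
    exact_mod_cast this
  have : NeZero N := ⟨hN0.ne'⟩
  have hp0 : 0 < p := by linarith
  have hVpos : 0 < volume (Metric.closedBall (0 : EuclideanSpace ℝ (Fin N)) μ) :=
    Metric.measure_closedBall_pos _ _ hμ
  obtain ⟨V, hV0, hV⟩ : ∃ V : ℝ, 0 < V ∧
      volume (Metric.closedBall (0 : EuclideanSpace ℝ (Fin N)) μ) = ENNReal.ofReal V := by
    have hlt : volume (Metric.closedBall (0 : EuclideanSpace ℝ (Fin N)) μ) ≠ ∞ :=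
      measure_closedBall_lt_top.ne
    exact ⟨_, ENNReal.toReal_pos hVpos.ne' hlt, (ENNReal.ofReal_toReal hlt).symm⟩
  obtain ⟨S, hS0, hS⟩ : ∃ S : ℝ, 0 < S ∧ S ^ p = 2 ^ (p - 1) * (I + V) := by
    refine ⟨(2 ^ (p - 1) * (I + V)) ^ (1 / p), by positivity, ?_⟩
    rw [← rpow_mul (by positivity), one_div_mul_cancel hp0.ne', rpow_one]
  refine ⟨c₂ * S, by positivity, ?_⟩
  intro y τ hτ g hg
  have hae : ∀ᵐ x : EuclideanSpace ℝ (Fin N), x ≠ y := compl_mem_ae_iff.2 (measure_singleton y)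
  have hm : Measurable fun x : EuclideanSpace ℝ (Fin N) =>
      ENNReal.ofReal (prof N β ‖g⁻¹ • (x - y)‖) ^ p :=
    (((prof_meas N β).comp (by fun_prop)).ennreal_ofReal).pow_const p
  have hball : volume (Metric.closedBall (0 : EuclideanSpace ℝ (Fin N)) (μ * g))
      = ENNReal.ofReal (g ^ (N:ℝ) * V) := by
    have h := Measure.addHaar_smul (volume : Measure (EuclideanSpace ℝ (Fin N))) g
      (Metric.closedBall (0 : EuclideanSpace ℝ (Fin N)) μ)
    rw [smul_closedBall _ _ hμ.le, smul_zero, Real.norm_of_nonneg hg.le,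
      finrank_euclideanSpace_fin, hV, abs_of_pos (by positivity),
      ← ENNReal.ofReal_mul (by positivity)] at h
    rw [mul_comm μ g, h, rpow_natCast]
  -- pointwise bound
  have hpt : ∀ x : EuclideanSpace ℝ (Fin N), x ≠ y →
      ‖Y (x - y) τ‖ₑ ≤ ENNReal.ofReal (c₂ * τ ^ (-1 - α) * g ^ (4 * β - (N:ℝ))) *
        (ENNReal.ofReal (prof N β ‖g⁻¹ • (x - y)‖) + 1) := by
    intro x hx
    have hxy : 0 < ‖x - y‖ := norm_pos_iff.2 (sub_ne_zero.2 hx)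
    refine (kernel_bound N α β hα hβ G hGnonneg c₂ hGin hGout Y hY
          (x - y) (sub_ne_zero.2 hx) τ hτ).trans ?_
    rw [← ENNReal.ofReal_one, ← ENNReal.ofReal_add (prof_nonneg _ _ _ (norm_nonneg _)) zero_le_one,
      ← ENNReal.ofReal_mul (by positivity), ← ENNReal.ofReal_mul (by positivity)]
    apply ENNReal.ofReal_le_ofReal
    have hr : 0 < τ ^ (-(α / (2 * β))) := by positivity
    have e1 : ∀ r : ℝ, 0 < r → prof N β r ≤ r ^ (4 * β - (N:ℝ)) := by
      intro r hr
      unfold prof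
      split_ifs with h
      · exact le_rfl
      · exact rpow_le_rpow_of_exponent_le (not_le.1 h).le (by linarith [hβ.1])
    have e2 : ∀ r : ℝ, 0 < r → r ^ (4 * β - (N:ℝ)) ≤ prof N β r + 1 := by
      intro r hr
      unfold prof
      split_ifs with h
      · linarith
      · have := rpow_le_one_of_one_le_of_nonpos (not_le.1 h).le
          (show 4 * β - (N:ℝ) ≤ 0 by linarith)
        have h2 : 0 ≤ r ^ (-((N : ℝ) + 2 * β)) := by positivity
        linarith
    have n1 : ‖(τ ^ (-(α / (2 * β)))) • (x - y)‖ = τ ^ (-(α / (2 * β))) * ‖x - y‖ := by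
      rw [norm_smul, Real.norm_of_nonneg hr.le]
    have n2 : ‖g⁻¹ • (x - y)‖ = g⁻¹ * ‖x - y‖ := by
      rw [norm_smul, Real.norm_of_nonneg (by positivity)]
    rw [n1, n2]
    have q1 := e1 (τ ^ (-(α / (2 * β))) * ‖x - y‖) (by positivity)
    have q2 := e2 (g⁻¹ * ‖x - y‖) (by positivity)
    calc τ ^ (α - 1 - α * (N : ℝ) / (2 * β)) * c₂ * prof N β (τ ^ (-(α / (2 * β))) * ‖x - y‖)
        ≤ τ ^ (α - 1 - α * (N : ℝ) / (2 * β)) * c₂ *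
          (τ ^ (-(α / (2 * β))) * ‖x - y‖) ^ (4 * β - (N:ℝ)) := by gcongr
      _ = c₂ * τ ^ (-1 - α) * g ^ (4 * β - (N:ℝ)) * (g⁻¹ * ‖x - y‖) ^ (4 * β - (N:ℝ)) := by
        rw [mul_rpow hr.le hxy.le, mul_rpow (by positivity) hxy.le, inv_rpow hg.le,
          ← rpow_mul hτ.le]
        have : τ ^ (-1 - α) = τ ^ (α - 1 - α * (N : ℝ) / (2 * β)) *
            τ ^ (-(α / (2 * β)) * (4 * β - (N:ℝ))) := by
          rw [← rpow_add hτ]; congr 1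
          have := hβ.1.ne'
          field_simp; ring
        rw [this]
        have hgp : g ^ (4 * β - (N:ℝ)) ≠ 0 := by positivity
        field_simp
      _ ≤ _ := by gcongr
  set A := c₂ * τ ^ (-1 - α) * g ^ (4 * β - (N:ℝ)) with hA
  have hA0 : 0 ≤ A := by positivity
  calc ∫⁻ x in Metric.closedBall 0 (μ * g), ‖Y (x - y) τ‖ₑ ^ p
      ≤ ∫⁻ x in Metric.closedBall 0 (μ * g), ENNReal.ofReal (A ^ p * 2 ^ (p - 1)) *
          (ENNReal.ofReal (prof N β ‖g⁻¹ • (x - y)‖) ^ p + 1) := by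
        apply lintegral_mono_ae
        filter_upwards [ae_restrict_of_ae hae] with x hx
        calc ‖Y (x - y) τ‖ₑ ^ p ≤ _ := ENNReal.rpow_le_rpow (hpt x hx) hp0.le
          _ = ENNReal.ofReal A ^ p * (ENNReal.ofReal (prof N β ‖g⁻¹ • (x - y)‖) + 1) ^ p :=
            ENNReal.mul_rpow_of_nonneg _ _ hp0.le
          _ ≤ ENNReal.ofReal A ^ p *
              (2 ^ (p - 1) * (ENNReal.ofReal (prof N β ‖g⁻¹ • (x - y)‖) ^ p + 1 ^ p)) := by
            gcongr
            exact ENNReal.rpow_add_le_mul_rpow_add_rpow _ _ hp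
          _ = _ := by
            rw [ENNReal.ofReal_mul (rpow_nonneg hA0 p), ← ENNReal.ofReal_rpow_of_nonneg hA0 hp0.le,
              ← ENNReal.ofReal_rpow_of_pos two_pos, ENNReal.one_rpow]
            simp [mul_assoc]
    _ = ENNReal.ofReal (A ^ p * 2 ^ (p - 1)) *
        ((∫⁻ x in Metric.closedBall 0 (μ * g), ENNReal.ofReal (prof N β ‖g⁻¹ • (x - y)‖) ^ p)
          + ENNReal.ofReal (g ^ (N:ℝ) * V)) := by
        rw [lintegral_const_mul _ (hm.add_const 1), lintegral_add_left hm, setLIntegral_one, hball]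
    _ ≤ ENNReal.ofReal (A ^ p * 2 ^ (p - 1)) *
        (ENNReal.ofReal (g⁻¹ ^ (-(N:ℝ)) * I) + ENNReal.ofReal (g ^ (N:ℝ) * V)) := by
        rw [← prof_scale N β p I g⁻¹ (by positivity) hI y]
        gcongr
        exact Measure.restrict_le_self
    _ = _ := by
        rw [← ENNReal.ofReal_add (by positivity) (by positivity),
          ← ENNReal.ofReal_mul (by positivity),
          ENNReal.ofReal_rpow_of_nonneg (by positivity) hp0.le]
        congr 1
        rw [hA]
        rw [mul_rpow (by positivity) (by positivity), mul_rpow (by positivity) (by positivity),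
          mul_rpow (by positivity) (by positivity), mul_rpow (by positivity) (by positivity),
          mul_rpow (by positivity) (by positivity), hS, inv_rpow hg.le, rpow_neg hg.le, inv_inv,
          ← rpow_mul hg.le, ← rpow_mul hg.le]
        have : g ^ ((4 * β - ↑N * (1 - 1 / p)) * p) = g ^ ((4 * β - ↑N) * p) * g ^ (N:ℝ) := by
          rw [← rpow_add hg]; congr 1; field_simp; ring
        rw [this]; ring


noncomputable def wt (α a T τ : ℝ) : ℝ :=
  if τ ≤ T then τ ^ (a - 1) else τ ^ (-1 - α) * T ^ (a + α)

lemma wt_meas (α a T : ℝ) : Measurable (wt α a T) := by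
  unfold wt
  exact Measurable.ite measurableSet_Iic (by fun_prop) (by fun_prop)

lemma time_est (α γ a : ℝ) (hα : 0 < α) (ha : 0 < a) :
    ∃ C : ℝ, 0 < C ∧ ∀ t T : ℝ, 2 ≤ t → 0 < T → T ≤ t / 2 →
      ∫⁻ s in Ioo 0 t, ENNReal.ofReal (wt α a T (t - s)) * ENNReal.ofReal ((1 + s) ^ (-γ)) ≤
        ENNReal.ofReal (C * T ^ a * (t ^ (-γ) +
          t ^ (-(1 + α)) * T ^ α * ∫ s in Ioo 0 (t / 2), (1 + s) ^ (-γ))) := by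
  refine ⟨2 ^ |γ| / a + 2 ^ |γ| / α + 2 ^ (1 + α), by positivity, ?_⟩
  intro t T ht hT hTt
  have ht0 : 0 < t := by linarith
  set J := ∫ s in Ioo 0 (t / 2), (1 + s) ^ (-γ) with hJ
  have hJ0 : 0 ≤ J := setIntegral_nonneg measurableSet_Ioo fun s hs => by
    have := hs.1
    positivity
  set k := 2 ^ |γ| * t ^ (-γ) with hk
  have hk0 : 0 ≤ k := by positivity
  have hkb : ∀ s, t / 2 ≤ s → s ≤ t → (1 + s) ^ (-γ) ≤ k := by
    intro s h1 h2
    have hs : 0 < 1 + s := by linarith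
    have e : (1 + s) ^ (-γ) = ((1 + s) / t) ^ (-γ) * t ^ (-γ) := by
      rw [← mul_rpow (by positivity) ht0.le, div_mul_cancel₀ _ ht0.ne']
    rw [e, hk]
    gcongr
    have l1 : 2⁻¹ ≤ (1 + s) / t := by rw [le_div_iff₀ ht0]; linarith
    have l2 : (1 + s) / t ≤ 2 := by rw [div_le_iff₀ ht0]; linarith
    rcases le_total 0 γ with h | h
    · rw [abs_of_nonneg h]
      calc ((1 + s) / t) ^ (-γ) ≤ (2⁻¹ : ℝ) ^ (-γ) :=
            rpow_le_rpow_of_nonpos (by norm_num) l1 (by linarith)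
        _ = 2 ^ γ := by rw [inv_rpow two_pos.le, rpow_neg two_pos.le, inv_inv]
    · rw [abs_of_nonpos h]
      exact rpow_le_rpow (by positivity) l2 (by linarith)
  set F1 : ℝ → ℝ≥0∞ := (Ioc 0 T).indicator fun τ => ENNReal.ofReal (τ ^ (a - 1)) with hF1
  set F2 : ℝ → ℝ≥0∞ := (Ioi T).indicator fun τ => ENNReal.ofReal (τ ^ (-1 - α)) with hF2
  set F3 : ℝ → ℝ≥0∞ := (Ioo 0 (t / 2)).indicator fun s => ENNReal.ofReal ((1 + s) ^ (-γ)) with hF3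
  have m1 : Measurable F1 := Measurable.indicator (by fun_prop) measurableSet_Ioc
  have m2 : Measurable F2 := Measurable.indicator (by fun_prop) measurableSet_Ioi
  have m3 : Measurable F3 := Measurable.indicator (by fun_prop) measurableSet_Ioo
  have i1 : ∫⁻ τ, F1 τ = ENNReal.ofReal (T ^ a / a) := by
    rw [hF1, lintegral_indicator measurableSet_Ioc, ← ofReal_integral_eq_lintegral_ofReal]
    · rw [← intervalIntegral.integral_of_le hT.le, integral_rpow (Or.inl (by linarith))]
      simp [ha.ne']
    · rw [← IntegrableOn, integrableOn_Ioc_iff_integrableOn_Ioo,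
        intervalIntegral.integrableOn_Ioo_rpow_iff hT]
      linarith
    · filter_upwards [ae_restrict_mem measurableSet_Ioc] with τ hτ
      exact rpow_nonneg hτ.1.le _
  have i2 : ∫⁻ τ, F2 τ = ENNReal.ofReal (T ^ (-α) / α) := by
    rw [hF2, lintegral_indicator measurableSet_Ioi, ← ofReal_integral_eq_lintegral_ofReal]
    · rw [integral_Ioi_rpow_of_lt (by linarith) hT]
      congr 1
      rw [show -1 - α + 1 = -α by ring, neg_div_neg_eq]
    · exact integrableOn_Ioi_rpow_of_lt (by linarith) hT
    · filter_upwards [ae_restrict_mem measurableSet_Ioi] with τ hτ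
      exact rpow_nonneg (hT.trans hτ).le _
  have i3 : ∫⁻ s, F3 s = ENNReal.ofReal J := by
    rw [hF3, lintegral_indicator measurableSet_Ioo, ← ofReal_integral_eq_lintegral_ofReal]
    · have : ContinuousOn (fun s : ℝ => (1 + s) ^ (-γ)) (Icc 0 (t / 2)) := by
        apply ContinuousOn.rpow_const (by fun_prop)
        intro s hs
        left
        linarith [hs.1]
      exact this.integrableOn_Icc.mono_set Ioo_subset_Icc_self
    · filter_upwards [ae_restrict_mem measurableSet_Ioo] with s hs
      have := hs.1
      exact rpow_nonneg (by linarith) _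
  have hpt : ∀ s ∈ Ioo 0 t, ENNReal.ofReal (wt α a T (t - s)) * ENNReal.ofReal ((1 + s) ^ (-γ)) ≤
      ENNReal.ofReal k * F1 (t - s) + ENNReal.ofReal (k * T ^ (a + α)) * F2 (t - s)
        + ENNReal.ofReal ((t / 2) ^ (-1 - α) * T ^ (a + α)) * F3 s := by
    intro s hs
    have hs0 := hs.1
    have hst := hs.2
    have hts : 0 < t - s := by linarith
    rcases le_or_gt (t - s) T with h | h
    · refine le_trans ?_ (le_trans le_self_add le_self_add)
      rw [hF1, indicator_of_mem (show t - s ∈ Ioc 0 T from ⟨hts, h⟩), wt, if_pos h, mul_comm]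
      gcongr
      exact hkb s (by linarith) hst.le
    · rw [wt, if_neg (not_le.2 h)]
      rcases lt_or_ge s (t / 2) with h2 | h2
      · refine le_trans ?_ le_add_self
        rw [hF3, indicator_of_mem (show s ∈ Ioo 0 (t / 2) from ⟨hs0, h2⟩)]
        gcongr ENNReal.ofReal (?_ * _) * _
        exact rpow_le_rpow_of_nonpos (by positivity) (by linarith) (by linarith)
      · refine le_trans ?_ (le_trans le_add_self le_self_add)
        rw [hF2, indicator_of_mem (show t - s ∈ Ioi T from h),
          ← ENNReal.ofReal_mul (by positivity), ← ENNReal.ofReal_mul (by positivity)]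
        apply ENNReal.ofReal_le_ofReal
        have := hkb s h2 hst.le
        calc (t - s) ^ (-1 - α) * T ^ (a + α) * (1 + s) ^ (-γ)
            ≤ (t - s) ^ (-1 - α) * T ^ (a + α) * k := by gcongr
          _ = _ := by ring
  calc _ ≤ ∫⁻ s in Ioo 0 t, (ENNReal.ofReal k * F1 (t - s) +
        ENNReal.ofReal (k * T ^ (a + α)) * F2 (t - s)
        + ENNReal.ofReal ((t / 2) ^ (-1 - α) * T ^ (a + α)) * F3 s) :=
        setLIntegral_mono' measurableSet_Ioo hpt
    _ ≤ ∫⁻ s, (ENNReal.ofReal k * F1 (t - s) + ENNReal.ofReal (k * T ^ (a + α)) * F2 (t - s)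
        + ENNReal.ofReal ((t / 2) ^ (-1 - α) * T ^ (a + α)) * F3 s) := setLIntegral_le_lintegral _ _
    _ = ENNReal.ofReal k * ENNReal.ofReal (T ^ a / a) +
        ENNReal.ofReal (k * T ^ (a + α)) * ENNReal.ofReal (T ^ (-α) / α) +
        ENNReal.ofReal ((t / 2) ^ (-1 - α) * T ^ (a + α)) * ENNReal.ofReal J := by
        have n1 : Measurable fun s => F1 (t - s) := m1.comp (by fun_prop)
        have n2 : Measurable fun s => F2 (t - s) := m2.comp (by fun_prop)
        rw [lintegral_add_right _ (m3.const_mul _),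
          lintegral_add_left (n1.const_mul _), lintegral_const_mul _ n1, lintegral_const_mul _ n2,
          lintegral_const_mul _ m3, lintegral_sub_left_eq_self F1, lintegral_sub_left_eq_self F2,
          i1, i2, i3]
    _ ≤ _ := by
        rw [← ENNReal.ofReal_mul (by positivity), ← ENNReal.ofReal_mul (by positivity),
          ← ENNReal.ofReal_mul (by positivity), ← ENNReal.ofReal_add (by positivity) (by positivity),
          ← ENNReal.ofReal_add (by positivity) (by positivity)]
        apply ENNReal.ofReal_le_ofReal
        have h1 : k * T ^ (a + α) * (T ^ (-α) / α) = 2 ^ |γ| / α * T ^ a * t ^ (-γ) := by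
          have : T ^ a = T ^ (a + α) * T ^ (-α) := by rw [← rpow_add hT]; congr 1; ring
          rw [this, hk]; ring
        have h2 : (t / 2) ^ (-1 - α) * T ^ (a + α) * J =
            2 ^ (1 + α) * T ^ a * (t ^ (-(1 + α)) * T ^ α * J) := by
          rw [rpow_add hT, div_rpow ht0.le two_pos.le, show -1 - α = -(1 + α) by ring,
            rpow_neg two_pos.le, div_inv_eq_mul]
          ring
        have h3 : k * (T ^ a / a) = 2 ^ |γ| / a * T ^ a * t ^ (-γ) := by
          rw [hk]; ring
        rw [h1, h2, h3]
        have p1 : 0 ≤ T ^ a * t ^ (-γ) := by positivity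
        have p2 : 0 ≤ T ^ a * (t ^ (-(1 + α)) * T ^ α * J) := by positivity
        have q1 : 0 ≤ (2 ^ |γ| / a + 2 ^ |γ| / α) * (T ^ a * (t ^ (-(1 + α)) * T ^ α * J)) := by
          positivity
        have q2 : 0 ≤ 2 ^ (1 + α) * (T ^ a * t ^ (-γ)) := by positivity
        nlinarith

lemma J_lt (γ t : ℝ) (h : γ < 1) (ht : 2 ≤ t) :
    ∫ s in Ioo 0 (t / 2), (1 + s) ^ (-γ) ≤ t ^ (1 - γ) / (1 - γ) := by
  rw [← integral_Ioc_eq_integral_Ioo, ← intervalIntegral.integral_of_le (by linarith),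
    intervalIntegral.integral_comp_add_left (fun s => s ^ (-γ)), integral_rpow (Or.inl (by linarith))]
  rw [show -γ + 1 = 1 - γ by ring]
  have h1 : (1 + t / 2) ^ (1 - γ) ≤ t ^ (1 - γ) :=
    rpow_le_rpow (by linarith) (by linarith) (by linarith)
  have : 0 < 1 - γ := by linarith
  gcongr
  simp only [add_zero, one_rpow]
  linarith

lemma J_eq (t : ℝ) (ht : 2 ≤ t) :
    ∫ s in Ioo 0 (t / 2), (1 + s) ^ (-(1:ℝ)) ≤ Real.log t := by
  rw [← integral_Ioc_eq_integral_Ioo, ← intervalIntegral.integral_of_le (by linarith),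
    intervalIntegral.integral_comp_add_left (fun s => s ^ (-(1:ℝ)))]
  simp_rw [rpow_neg_one]
  rw [integral_inv_of_pos (by norm_num) (by linarith)]
  apply log_le_log <;> simp <;> linarith

lemma J_gt (γ t : ℝ) (h : 1 < γ) (ht : 2 ≤ t) :
    ∫ s in Ioo 0 (t / 2), (1 + s) ^ (-γ) ≤ 1 / (γ - 1) := by
  rw [← integral_Ioc_eq_integral_Ioo, ← intervalIntegral.integral_of_le (by linarith),
    intervalIntegral.integral_comp_add_left (fun s => s ^ (-γ)), integral_rpow]
  · rw [← neg_div_neg_eq, show -(-γ + 1) = γ - 1 by ring]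
    have h1 : 0 ≤ (1 + t / 2) ^ (-γ + 1) := rpow_nonneg (by linarith) _
    have : 0 < γ - 1 := by linarith
    gcongr
    simp only [add_zero, one_rpow]
    linarith
  · right
    refine ⟨by linarith, ?_⟩
    rw [uIcc_of_le (by linarith)]
    intro h
    linarith [h.1]


lemma wt_pos (α a T τ : ℝ) (hT : 0 < T) (hτ : 0 < τ) : 0 < wt α a T τ := by
  unfold wt; split_ifs <;> positivity

lemma core (N : ℕ) (Y : EuclideanSpace ℝ (Fin N) → ℝ → ℝ)
    (hYm : Measurable (Function.uncurry Y))
    (f : EuclideanSpace ℝ (Fin N) → ℝ → ℝ)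
    (hfmeas : Measurable (Function.uncurry f))
    (φ : ℝ → ℝ≥0∞)
    (hf1 : ∀ t : ℝ, 0 ≤ t → eLpNorm (fun y => f y t) 1 volume ≤ φ t)
    (u : EuclideanSpace ℝ (Fin N) → ℝ → ℝ)
    (hu : ∀ x t, u x t = ∫ s in Set.Ioc (0:ℝ) t, ∫ y, Y (x - y) (t - s) * f y s)
    (p : ℝ) (hp1 : 1 ≤ p) (B : Set (EuclideanSpace ℝ (Fin N)))
    (v : ℝ → ℝ) (hv : Measurable v) (hv0 : ∀ τ, 0 < τ → 0 < v τ)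
    (hker : ∀ y τ, 0 < τ → ∫⁻ x in B, ‖Y (x - y) τ‖ₑ ^ p ≤ ENNReal.ofReal (v τ) ^ p) (t : ℝ) :
    eLpNorm (fun x => u x t) (ENNReal.ofReal p) (volume.restrict B) ≤
      ∫⁻ s in Ioo 0 t, ENNReal.ofReal (v (t - s)) * φ s := by
  have hp0 : 0 < p := by linarith
  set P : Measure (EuclideanSpace ℝ (Fin N) × ℝ) :=
    (volume : Measure (EuclideanSpace ℝ (Fin N))).prod (volume.restrict (Ioo 0 t)) with hP
  have hfm : Measurable fun z : EuclideanSpace ℝ (Fin N) × ℝ => ‖f z.1 z.2‖ₑ := hfmeas.enorm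
  set m := P.withDensity (fun z => ‖f z.1 z.2‖ₑ) with hm
  set K : EuclideanSpace ℝ (Fin N) → EuclideanSpace ℝ (Fin N) × ℝ → ℝ≥0∞ :=
    fun x z => ‖Y (x - z.1) (t - z.2)‖ₑ with hK
  have hKm : Measurable (Function.uncurry K) := by
    have h1 : Measurable fun q : EuclideanSpace ℝ (Fin N) × (EuclideanSpace ℝ (Fin N) × ℝ) =>
      (q.1 - q.2.1, t - q.2.2) := by fun_prop
    exact (hYm.comp h1).enorm
  have hKx : ∀ x, Measurable (K x) := fun x => hKm.comp measurable_prodMk_left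
  have hub : ∀ x, ‖u x t‖ₑ ≤ ∫⁻ z, K x z ∂m := by
    intro x
    rw [hu, integral_Ioc_eq_integral_Ioo, hm,
      lintegral_withDensity_eq_lintegral_mul _ hfm (hKx x), hP,
      lintegral_prod_symm _ (hfm.mul (hKx x)).aemeasurable]
    refine (enorm_integral_le_lintegral_enorm _).trans ?_
    apply lintegral_mono
    intro s
    refine (enorm_integral_le_lintegral_enorm _).trans ?_
    apply lintegral_mono
    intro y
    simp only [enorm_mul, Pi.mul_apply, hK]
    rw [mul_comm]
  set w : EuclideanSpace ℝ (Fin N) × ℝ → ℝ≥0∞ :=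
    fun z => if z.2 < t then ENNReal.ofReal (v (t - z.2)) else 1 with hw
  have hwm : Measurable w := by
    refine Measurable.ite (measurableSet_lt measurable_snd measurable_const) ?_ measurable_const
    exact (hv.comp (by fun_prop)).ennreal_ofReal
  have hmz : ∀ᵐ z ∂P, z.2 ∈ Ioo 0 t := by
    exact Measure.quasiMeasurePreserving_snd.ae (ae_restrict_mem measurableSet_Ioo)
  have hJ := jensen_mink (volume.restrict B) m K hKm w hwm
    (by
      intro z
      simp only [hw]
      split_ifs with h
      · exact (ENNReal.ofReal_pos.2 (hv0 _ (by linarith))).ne'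
      · exact one_ne_zero)
    (by
      intro z
      simp only [hw]
      split_ifs with h
      · exact ENNReal.ofReal_ne_top
      · exact ENNReal.one_ne_top) p hp1
    (by
      have := (withDensity_absolutelyContinuous P (fun z => ‖f z.1 z.2‖ₑ)).ae_le hmz
      filter_upwards [this] with z hz
      have hz2 : z.2 < t := hz.2
      simp only [hw, if_pos hz2, hK]
      exact hker z.1 (t - z.2) (by linarith))
  have hW : ∫⁻ z, w z ∂m ≤ ∫⁻ s in Ioo 0 t, ENNReal.ofReal (v (t - s)) * φ s := by
    rw [hm, lintegral_withDensity_eq_lintegral_mul _ hfm hwm, hP,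
      lintegral_prod_symm _ (hfm.mul hwm).aemeasurable]
    apply setLIntegral_mono' measurableSet_Ioo
    intro s hs
    simp only [Pi.mul_apply, hw, if_pos hs.2]
    have hfs : Measurable fun y => ‖f y s‖ₑ := hfm.comp measurable_prodMk_right
    rw [lintegral_mul_const _ hfs, mul_comm]
    gcongr
    have := hf1 s hs.1.le
    rwa [eLpNorm_one_eq_lintegral_enorm] at this
  rw [eLpNorm_eq_lintegral_rpow_enorm_toReal (ENNReal.ofReal_pos.2 hp0).ne' ENNReal.ofReal_ne_top,
    ENNReal.toReal_ofReal hp0.le]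
  calc (∫⁻ x in B, ‖u x t‖ₑ ^ p) ^ (1 / p)
      ≤ (∫⁻ x in B, (∫⁻ z, K x z ∂m) ^ p) ^ (1 / p) := by
        gcongr with x
        exact hub x
    _ ≤ ((∫⁻ z, w z ∂m) ^ p) ^ (1 / p) := by gcongr
    _ = ∫⁻ z, w z ∂m := by
        rw [← ENNReal.rpow_mul, mul_one_div_cancel hp0.ne', ENNReal.rpow_one]
    _ ≤ _ := hW


theorem intermediate_decay_subcritical
    (N : ℕ) (α β : ℝ)
    (hα : 0 < α ∧ α < 1) (hβ : 0 < β ∧ β ≤ 1) (hN : 4 * β < (N : ℝ))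
    (G : EuclideanSpace ℝ (Fin N) → ℝ)
    (hGmeas : Measurable G) (hGnonneg : ∀ ξ, 0 ≤ G ξ)
    (c₁ c₂ : ℝ) (hc₁ : 0 < c₁) (hc₂ : 0 < c₂)
    (hGin : ∀ ξ : EuclideanSpace ℝ (Fin N), 0 < ‖ξ‖ → ‖ξ‖ ≤ 1 →
      c₁ * ‖ξ‖ ^ (4 * β - (N : ℝ)) ≤ G ξ ∧ G ξ ≤ c₂ * ‖ξ‖ ^ (4 * β - (N : ℝ)))
    (hGout : ∀ ξ : EuclideanSpace ℝ (Fin N), 1 ≤ ‖ξ‖ →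
      c₁ * ‖ξ‖ ^ (-((N : ℝ) + 2 * β)) ≤ G ξ ∧ G ξ ≤ c₂ * ‖ξ‖ ^ (-((N : ℝ) + 2 * β)))
    (Y : EuclideanSpace ℝ (Fin N) → ℝ → ℝ)
    (hY : ∀ x t, Y x t = t ^ (α - 1 - α * (N : ℝ) / (2 * β)) * G ((t ^ (-(α / (2 * β)))) • x))
    (f : EuclideanSpace ℝ (Fin N) → ℝ → ℝ)
    (hfmeas : Measurable (Function.uncurry f))
    (γ : ℝ) (C₀ : ℝ) (hC₀ : 0 < C₀)
    (hf1 : ∀ t : ℝ, 0 ≤ t →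
      eLpNorm (fun y => f y t) 1 volume ≤ ENNReal.ofReal (C₀ * (1 + t) ^ (-γ)))
    (u : EuclideanSpace ℝ (Fin N) → ℝ → ℝ)
    (hu : ∀ x t, u x t = ∫ s in Set.Ioc (0:ℝ) t, ∫ y, Y (x - y) (t - s) * f y s)
    (p : ℝ) (hp1 : 1 ≤ p) (hpc : p < (N : ℝ) / ((N : ℝ) - 2 * β))
    (ν μ : ℝ) (hν : 0 < ν) (hνμ : ν < μ)
    (g : ℝ → ℝ) (hgpos : ∀ t : ℝ, 0 < t → 0 < g t)
    (hginf : Tendsto g atTop atTop)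
    (hgo : Tendsto (fun t => g t / t ^ (α / (2 * β))) atTop (nhds 0)) :
    ∃ C : ℝ, 0 < C ∧ ∃ t₀ : ℝ, 2 ≤ t₀ ∧ ∀ t : ℝ, t₀ ≤ t →
      (γ < 1 →
        eLpNorm (fun x => u x t) (ENNReal.ofReal p) (volume.restrict {x : EuclideanSpace ℝ (Fin N) | ν ≤ ‖x‖ / g t ∧ ‖x‖ / g t ≤ μ}) ≤
          ENNReal.ofReal (C * g t ^ (2 * β - (N : ℝ) * (1 - 1 / p)) * t ^ (-γ))) ∧
      (γ = 1 →
        eLpNorm (fun x => u x t) (ENNReal.ofReal p) (volume.restrict {x : EuclideanSpace ℝ (Fin N) | ν ≤ ‖x‖ / g t ∧ ‖x‖ / g t ≤ μ}) ≤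
          ENNReal.ofReal (C * g t ^ (2 * β - (N : ℝ) * (1 - 1 / p)) *
            max (t ^ (-1 : ℝ)) (t ^ (-(1 + α)) * g t ^ (2 * β) * Real.log t))) ∧
      (1 < γ →
        eLpNorm (fun x => u x t) (ENNReal.ofReal p) (volume.restrict {x : EuclideanSpace ℝ (Fin N) | ν ≤ ‖x‖ / g t ∧ ‖x‖ / g t ≤ μ}) ≤
          ENNReal.ofReal (C * g t ^ (2 * β - (N : ℝ) * (1 - 1 / p)) *
            max (t ^ (-γ)) (t ^ (-(1 + α)) * g t ^ (2 * β)))) := by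
  obtain ⟨hβ0, hβ1⟩ := hβ
  have hNpos : (0:ℝ) < N := by linarith
  have hp0 : 0 < p := by linarith
  have hμ : 0 < μ := hν.trans hνμ
  have hpN : p * (N - 2 * β) < N := by
    rwa [lt_div_iff₀ (by linarith)] at hpc
  have hpp : p * (N - 4 * β) < N := by nlinarith
  obtain ⟨I, hI0, hI⟩ := prof_fin N β p hβ0 hN hp1 hpp
  obtain ⟨D₂, hD₂, hk2⟩ := kernel2 N α β hα ⟨hβ0, hβ1⟩ hN G hGnonneg c₂ hc₂
    (fun ξ h1 h2 => (hGin ξ h1 h2).2) (fun ξ h1 => (hGout ξ h1).2) Y hY p hp1 I hI0 hI μ hμ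
  have hk1 := kernel1 N α β hα ⟨hβ0, hβ1⟩ hN G hGnonneg c₂ hc₂
    (fun ξ h1 h2 => (hGin ξ h1 h2).2) (fun ξ h1 => (hGout ξ h1).2) Y hY p hp1 I hI0 hI
  set a := α - α * N / (2 * β) * (1 - 1 / p) with ha
  have ha0 : 0 < a := by
    have h1 : (N:ℝ) * (1 - 1 / p) < 2 * β := by
      have : (N:ℝ) * (1 - 1 / p) = (N * p - N) / p := by field_simp
      rw [this, div_lt_iff₀ hp0]
      linarith
    have h2 : a = α / (2 * β) * (2 * β - N * (1 - 1 / p)) := by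
      rw [ha]; field_simp
    rw [h2]
    exact mul_pos (by have := hα.1; positivity) (by linarith)
  obtain ⟨C, hC, hT⟩ := time_est α γ a hα.1 ha0
  set D := c₂ * I ^ (1 / p) + D₂ with hD
  have hI' : 0 ≤ c₂ * I ^ (1 / p) := by positivity
  have hD0 : 0 < D := by positivity
  have hYm : Measurable (Function.uncurry Y) := by
    have : Function.uncurry Y = fun q : EuclideanSpace ℝ (Fin N) × ℝ =>
        q.2 ^ (α - 1 - α * (N : ℝ) / (2 * β)) * G ((q.2 ^ (-(α / (2 * β)))) • q.1) := by
      ext q; exact hY q.1 q.2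
    rw [this]
    have h1 : Measurable fun q : EuclideanSpace ℝ (Fin N) × ℝ =>
      (q.2 ^ (-(α / (2 * β)))) • q.1 := by fun_prop
    exact Measurable.mul (by fun_prop) (hGmeas.comp h1)
  have hε : (0:ℝ) < (1 / 2) ^ (α / (2 * β)) := by positivity
  obtain ⟨t₁, ht₁⟩ := eventually_atTop.1 (hgo.eventually (gt_mem_nhds hε))
  have hα0 := hα.1
  -- main estimate
  have main : ∀ t, max 2 t₁ ≤ t → (g t ^ (2 * β) ≤ t ^ α) ∧
      eLpNorm (fun x => u x t) (ENNReal.ofReal p) (volume.restrict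
        {x : EuclideanSpace ℝ (Fin N) | ν ≤ ‖x‖ / g t ∧ ‖x‖ / g t ≤ μ}) ≤
      ENNReal.ofReal ((D * C₀ * C) * g t ^ (2 * β - (N : ℝ) * (1 - 1 / p)) * (t ^ (-γ) +
          t ^ (-(1 + α)) * g t ^ (2 * β) * ∫ s in Ioo 0 (t / 2), (1 + s) ^ (-γ))) := by
    intro t ht
    have ht2 : 2 ≤ t := (le_max_left _ _).trans ht
    have ht0 : 0 < t := by linarith
    have hg : 0 < g t := hgpos t ht0
    have hgt := ht₁ t ((le_max_right _ _).trans ht)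
    rw [div_lt_iff₀ (by positivity), ← mul_rpow (by positivity) ht0.le] at hgt
    set T := g t ^ (2 * β / α) with hTdef
    have hT0 : 0 < T := by positivity
    have hTt : T ≤ t / 2 := by
      calc T ≤ ((1 / 2 * t) ^ (α / (2 * β))) ^ (2 * β / α) :=
            rpow_le_rpow hg.le hgt.le (by positivity)
        _ = t / 2 := by
            rw [← rpow_mul (by positivity), show α / (2 * β) * (2 * β / α) = 1 by field_simp,
              rpow_one]
            ring
    have hTα : T ^ α = g t ^ (2 * β) := by
      rw [hTdef, ← rpow_mul hg.le]; congr 1; field_simp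
    have hTa : T ^ a = g t ^ (2 * β - (N : ℝ) * (1 - 1 / p)) := by
      rw [hTdef, ← rpow_mul hg.le, ha]; congr 1; field_simp
    have hTaα : T ^ (a + α) = g t ^ (4 * β - (N : ℝ) * (1 - 1 / p)) := by
      rw [rpow_add hT0, hTα, hTa, ← rpow_add hg]; congr 1; ring
    refine ⟨?_, ?_⟩
    · rw [← hTα]
      exact rpow_le_rpow hT0.le (by linarith) hα0.le
    have hsub : {x : EuclideanSpace ℝ (Fin N) | ν ≤ ‖x‖ / g t ∧ ‖x‖ / g t ≤ μ} ⊆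
        Metric.closedBall 0 (μ * g t) := by
      rintro x ⟨-, hx⟩
      rw [mem_closedBall_zero_iff]
      rwa [div_le_iff₀ hg] at hx
    have hker : ∀ (y : EuclideanSpace ℝ (Fin N)) (τ : ℝ), 0 < τ →
        ∫⁻ x in Metric.closedBall 0 (μ * g t), ‖Y (x - y) τ‖ₑ ^ p ≤
          ENNReal.ofReal (D * wt α a T τ) ^ p := by
      intro y τ hτ
      unfold wt
      split_ifs with h
      · refine (setLIntegral_le_lintegral _ _).trans ((hk1 y τ hτ).trans ?_)
        rw [show α - 1 - α * (N:ℝ) / (2 * β) * (1 - 1 / p) = a - 1 by rw [ha]; ring]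
        gcongr
        linarith
      · refine (hk2 y τ hτ (g t) hg).trans ?_
        rw [hTaα]
        gcongr
        linarith
    refine (eLpNorm_mono_measure _ (Measure.restrict_mono_set _ hsub)).trans ?_
    refine (core N Y hYm f hfmeas _ hf1 u hu p hp1 _ (fun τ => D * wt α a T τ)
      ((wt_meas α a T).const_mul D) (fun τ hτ => mul_pos hD0 (wt_pos α a T τ hT0 hτ))
      hker t).trans ?_
    calc ∫⁻ s in Ioo 0 t, ENNReal.ofReal (D * wt α a T (t - s)) *
          ENNReal.ofReal (C₀ * (1 + s) ^ (-γ))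
        = ∫⁻ s in Ioo 0 t, ENNReal.ofReal (D * C₀) * (ENNReal.ofReal (wt α a T (t - s)) *
          ENNReal.ofReal ((1 + s) ^ (-γ))) := by
          apply lintegral_congr
          intro s
          rw [ENNReal.ofReal_mul hD0.le, ENNReal.ofReal_mul hC₀.le, ENNReal.ofReal_mul hD0.le]
          ring
      _ = ENNReal.ofReal (D * C₀) * ∫⁻ s in Ioo 0 t, (ENNReal.ofReal (wt α a T (t - s)) *
          ENNReal.ofReal ((1 + s) ^ (-γ))) := lintegral_const_mul' _ _ ENNReal.ofReal_ne_top
      _ ≤ _ := by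
          refine (mul_le_mul_right (hT t T ht2 hT0 hTt) _).trans ?_
          rw [← ENNReal.ofReal_mul (by positivity), hTa, hTα]
          apply ENNReal.ofReal_le_ofReal
          apply le_of_eq
          ring
  have hDC : 0 < D * C₀ * C := by positivity
  -- it suffices to bound the bracket
  have fin : ∀ (c : ℝ), 0 ≤ c → ∀ t, max 2 t₁ ≤ t → ∀ R : ℝ,
      (t ^ (-γ) + t ^ (-(1 + α)) * g t ^ (2 * β) * ∫ s in Ioo 0 (t / 2), (1 + s) ^ (-γ)
        ≤ (1 + c) * R) →
      eLpNorm (fun x => u x t) (ENNReal.ofReal p) (volume.restrict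
        {x : EuclideanSpace ℝ (Fin N) | ν ≤ ‖x‖ / g t ∧ ‖x‖ / g t ≤ μ}) ≤
      ENNReal.ofReal ((D * C₀ * C * (1 + c)) * g t ^ (2 * β - (N : ℝ) * (1 - 1 / p)) * R) := by
    intro c hc t ht R hR
    have ht0 : 0 < t := lt_of_lt_of_le two_pos ((le_max_left _ _).trans ht)
    have hg := hgpos t ht0
    refine (main t ht).2.trans (ENNReal.ofReal_le_ofReal ?_)
    calc _ ≤ (D * C₀ * C) * g t ^ (2 * β - (N : ℝ) * (1 - 1 / p)) * ((1 + c) * R) := by gcongr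
      _ = _ := by ring
  have hcpos : 0 ≤ |1 - γ|⁻¹ + 1 := by positivity
  refine ⟨D * C₀ * C * (1 + (|1 - γ|⁻¹ + 1)), by positivity, max 2 t₁, le_max_left _ _, ?_⟩
  intro t ht
  have ht2 : 2 ≤ t := (le_max_left _ _).trans ht
  have ht0 : 0 < t := by linarith
  have hg := hgpos t ht0
  have hgb := (main t ht).1
  refine ⟨fun hγ => fin _ hcpos t ht _ ?_, fun hγ => fin _ hcpos t ht _ ?_,
    fun hγ => fin _ hcpos t ht _ ?_⟩
  · have h1 : 0 < 1 - γ := by linarith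
    have hJ := J_lt γ t hγ ht2
    rw [abs_of_pos h1]
    have hJ0 : 0 ≤ ∫ s in Ioo 0 (t / 2), (1 + s) ^ (-γ) :=
      setIntegral_nonneg measurableSet_Ioo fun s hs => by
        have := hs.1
        positivity
    have : t ^ (-(1 + α)) * g t ^ (2 * β) * ∫ s in Ioo 0 (t / 2), (1 + s) ^ (-γ) ≤
        (1 - γ)⁻¹ * t ^ (-γ) := by
      calc _ ≤ t ^ (-(1 + α)) * t ^ α * (t ^ (1 - γ) / (1 - γ)) := by gcongr
        _ = (1 - γ)⁻¹ * t ^ (-γ) := by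
          have : t ^ (-γ) = t ^ (-(1 + α)) * t ^ α * t ^ (1 - γ) := by
            rw [← rpow_add ht0, ← rpow_add ht0]; congr 1; ring
          rw [this]; field_simp
    have h3 : 0 ≤ t ^ (-γ) := by positivity
    linarith
  · subst hγ
    have hJ := J_eq t ht2
    have hl := log_nonneg (show 1 ≤ t by linarith)
    have h1 : t ^ (-(1 + α)) * g t ^ (2 * β) * ∫ s in Ioo 0 (t / 2), (1 + s) ^ (-(1:ℝ)) ≤
        t ^ (-(1 + α)) * g t ^ (2 * β) * Real.log t := by gcongr
    have h2 := le_max_left (t ^ (-1 : ℝ)) (t ^ (-(1 + α)) * g t ^ (2 * β) * Real.log t)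
    have h3 := le_max_right (t ^ (-1 : ℝ)) (t ^ (-(1 + α)) * g t ^ (2 * β) * Real.log t)
    simp only [sub_self, abs_zero, inv_zero, zero_add]
    linarith
  · have h1 : 0 < γ - 1 := by linarith
    have hJ := J_gt γ t hγ ht2
    rw [abs_sub_comm, abs_of_pos h1]
    have h2 := le_max_left (t ^ (-γ)) (t ^ (-(1 + α)) * g t ^ (2 * β))
    have h3 := le_max_right (t ^ (-γ)) (t ^ (-(1 + α)) * g t ^ (2 * β))
    set M := max (t ^ (-γ)) (t ^ (-(1 + α)) * g t ^ (2 * β)) with hM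
    have hM0 : 0 ≤ M := le_trans (by positivity) h2
    have : t ^ (-(1 + α)) * g t ^ (2 * β) * ∫ s in Ioo 0 (t / 2), (1 + s) ^ (-γ) ≤
        M * (γ - 1)⁻¹ := by
      calc _ ≤ t ^ (-(1 + α)) * g t ^ (2 * β) * (1 / (γ - 1)) := by gcongr
        _ ≤ M * (1 / (γ - 1)) := by gcongr
        _ = _ := by rw [one_div]
    linarith
end
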